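/- arXiv:2111.10279 — 2 statements merged into one kernel-verified Lean document; each statement's English description precedes it below -/
import Mathlib

section
/- For all integers n ≥ 0, 0 ≤ i ≤ n and m ≥ 0, one has C_{i,n}(m) = M_{i,n}(m); that is, the coloured partitions with absolute-value difference conditions counted by C_{i,n} are equinumerous with the Meurman–Primc partitions counted by M_{i,n}. -/
open scoped BigOperators

/-- Coloured partitions with equality difference conditions `λ_j − λ_{j+1} = |u_j − u_{j+1}|`,
last part `0` with colour `i`, penultimate part (if any) of colour different from `i`,
weight `m`. -/
def CeqSet (n i m : ℕ) : Set (List (ℤ × ℕ)) :=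
  {L | (∀ p ∈ L, p.2 ≤ n) ∧
       List.Chain' (fun x y => x.1 - y.1 = |(x.2 : ℤ) - (y.2 : ℤ)|) L ∧
       L.getLast? = some (0, i) ∧
       (∀ p ∈ L.reverse[1]?, p.2 ≠ i) ∧
       (L.map Prod.fst).sum = (m : ℤ)}

/-- `C_{i,n}(m)`. -/
noncomputable def Ceq (n i m : ℕ) : ℕ := (CeqSet n i m).ncard

/-- Meurman–Primc partitions for parameters `(i,n)` and weight `m`, recorded by the pair of
frequency functions: `fg.1 k` is the frequency of the plain part `k` and `fg.2 k` is the
frequency of the underlined part `k` (parts are positive integers, so frequency of `0` is `0`). -/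
def MPSet (n i m : ℕ) : Set ((ℕ →₀ ℕ) × (ℕ →₀ ℕ)) :=
  {fg | fg.1 0 = 0 ∧ fg.2 0 = 0 ∧
        (∀ k ≥ 1, fg.2 (2 * k) = 0) ∧
        (∀ k ≥ 1, fg.1 (2 * k + 1) + fg.1 (2 * k) + fg.1 (2 * k - 1) ≤ n) ∧
        (∀ k ≥ 1, fg.1 (2 * k) + fg.2 (2 * k - 1) + fg.1 (2 * k - 1) ≤ n) ∧
        (∀ k ≥ 1, fg.2 (2 * k + 1) + fg.1 (2 * k + 1) + fg.1 (2 * k) ≤ n) ∧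
        (∀ k ≥ 1, fg.2 (2 * k + 1) + fg.1 (2 * k) + fg.2 (2 * k - 1) ≤ n) ∧
        fg.2 1 ≤ i ∧ fg.1 1 ≤ n - i ∧
        (fg.1.sum fun k v => k * v) + (fg.2.sum fun k v => k * v) = m}

/-- `M_{i,n}(m)`: the number of Meurman–Primc partitions of weight `m`. -/
noncomputable def MP (n i m : ℕ) : ℕ := (MPSet n i m).ncard

namespace MeurmanPrimc

open Finset PowerSeries

/-- The inverse of `1 - X ^ a` (for `a > 0`). -/
noncomputable def geomInv (a : ℕ) : ℚ⟦X⟧ := (1 - X ^ a)⁻¹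

lemma one_sub_mul_geomInv {a : ℕ} (ha : 0 < a) : (1 - X ^ a) * geomInv a = 1 := by
  apply PowerSeries.mul_inv_cancel
  simp [ha.ne']

lemma sum_X_pow_mul (b s : ℕ) (hb : 0 < b) :
    ∑ j ∈ range s, (X : ℚ⟦X⟧) ^ (b * j) = (1 - X ^ (b * s)) * geomInv b := by
  have h := geom_sum_mul_neg ((X : ℚ⟦X⟧) ^ b) s
  have h1 := one_sub_mul_geomInv hb
  simp only [← pow_mul] at h
  rw [← h]
  linear_combination (-∑ j ∈ range s, (X : ℚ⟦X⟧) ^ (b * j)) * h1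

/-- The kernel `x ^ (N - |N - l - a|)` on `{0, …, N}`. -/
def tentKernel {R : Type*} [CommRing R] (x : R) (N l a : ℕ) : R := x ^ min (l + a) (2 * N - l - a)

lemma tentKernel_reflect {R : Type*} [CommRing R] (x : R) {N l a : ℕ} (hl : l ≤ N) (ha : a ≤ N) :
    tentKernel x N (N - l) (N - a) = tentKernel x N l a := by
  unfold tentKernel
  congr 1
  omega

lemma tentKernel_sum_pow (k i p l : ℕ) :
    ∑ j ∈ range (p + l + 1),
        tentKernel ((X : ℚ⟦X⟧) ^ k) (p + l) l j * X ^ ((k + 1 + i) * j) =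
      X ^ (k * l) * geomInv (2 * k + 1 + i)
        + X ^ (k * (p + l) + (k + 1 + i) * p) * (geomInv (i + 1) - geomInv (2 * k + 1 + i))
        - X ^ (k * p + k * (p + l) + (i + 1) * (p + l + 1)) * geomInv (i + 1) := by
  rw [add_assoc p l 1, sum_range_add]
  have h1 : ∑ j ∈ range p, tentKernel ((X : ℚ⟦X⟧) ^ k) (p + l) l j * X ^ ((k + 1 + i) * j)
      = X ^ (k * l) * ((1 - X ^ ((2 * k + 1 + i) * p)) * geomInv (2 * k + 1 + i)) := by
    rw [← sum_X_pow_mul _ _ (by omega), mul_sum]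
    refine sum_congr rfl fun j hj => ?_
    rw [mem_range] at hj
    unfold tentKernel
    rw [min_eq_left (by omega), ← pow_mul, ← pow_add, ← pow_add]
    ring_nf
  have h2 : ∑ j ∈ range (l + 1),
      tentKernel ((X : ℚ⟦X⟧) ^ k) (p + l) l (p + j) * X ^ ((k + 1 + i) * (p + j))
      = X ^ (k * (p + l) + (k + 1 + i) * p) *
        ((1 - X ^ ((i + 1) * (l + 1))) * geomInv (i + 1)) := by
    rw [← sum_X_pow_mul _ _ (by omega), mul_sum]
    refine sum_congr rfl fun j hj => ?_
    rw [mem_range] at hj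
    obtain ⟨t, rfl⟩ : ∃ t, l = j + t := ⟨l - j, by omega⟩
    unfold tentKernel
    rw [min_eq_right (by omega), ← pow_mul, ← pow_add, ← pow_add,
      show 2 * (p + (j + t)) - (j + t) - (p + j) = p + t by omega]
    ring_nf
  rw [h1, h2]
  ring

/-- The product `∏_{t < i} (1 - X ^ (a + t)) / (1 - X ^ (t + 1))`. -/
noncomputable def qBinom (a i : ℕ) : ℚ⟦X⟧ := ∏ t ∈ range i, ((1 - X ^ (a + t)) * geomInv (t + 1))

@[simp] lemma qBinom_zero_right (a : ℕ) : qBinom a 0 = 1 := by simp [qBinom]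

lemma qBinom_succ_right (a i : ℕ) :
    qBinom a (i + 1) = qBinom a i * ((1 - X ^ (a + i)) * geomInv (i + 1)) := by
  simp [qBinom, prod_range_succ]

lemma qBinom_succ_left (a i : ℕ) :
    qBinom (a + 1) i * (1 - X ^ a) = qBinom a i * (1 - X ^ (a + i)) := by
  induction i with
  | zero => simp
  | succ i ih =>
    rw [qBinom_succ_right, qBinom_succ_right]
    rw [show a + 1 + i = a + (i + 1) by ring]
    linear_combination (1 - X ^ (a + (i + 1))) * geomInv (i + 1) * ih

/-- The `i`-th exponential mode at level `k`. -/
noncomputable def mode (N k i l : ℕ) : ℚ⟦X⟧ :=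
  if Even i then X ^ ((i + k) * l) else X ^ ((i + k) * (N - l))

/-- The coefficient of the `i`-th mode at level `k`. -/
noncomputable def modeCoeff (N k i : ℕ) : ℚ⟦X⟧ :=
  X ^ (N * (k * i + i.choose 2) + (i + 1).choose 2) * qBinom (2 * k) i

/-- The boundary contribution produced by the `i`-th mode at level `k`. -/
noncomputable def modeBoundary (N k i : ℕ) : ℚ⟦X⟧ :=
  X ^ (N * (k * i + (i + 1).choose 2) + (i + 1).choose 2) * qBinom (2 * k + 1) i

/-- The solution of the homogeneous boundary problem, alternating between the two ends. -/
noncomputable def endMode (N k i l : ℕ) : ℚ⟦X⟧ :=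
  if Even i then X ^ (k * l) else X ^ (k * (N - l))

lemma choose_succ_two (i : ℕ) : (i + 1).choose 2 = i + i.choose 2 := by
  rw [Nat.choose_succ_succ' i 1, Nat.choose_one_right]

lemma modeCoeff_mul_sum (N k i l : ℕ) (hl : l ≤ N) :
    (1 - X ^ (2 * k + 1)) * modeCoeff N (k + 1) i *
      ∑ j ∈ range (N + 1), tentKernel ((X : ℚ⟦X⟧) ^ k) N l j * X ^ ((i + (k + 1)) * j) =
    modeCoeff N k (i + 1) * X ^ ((i + 1 + k) * (N - l)) + modeBoundary N k i * X ^ (k * l)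
      - modeBoundary N k (i + 1) * X ^ (k * (N - l)) := by
  obtain ⟨p, rfl⟩ : ∃ p, N = p + l := ⟨N - l, by omega⟩
  rw [Nat.add_sub_cancel, show i + (k + 1) = k + 1 + i by ring, tentKernel_sum_pow]
  have ha := qBinom_succ_left (2 * k + 1) i
  have hb := qBinom_succ_left (2 * k) i
  have hv := one_sub_mul_geomInv (a := i + 1) (by omega)
  have hw := one_sub_mul_geomInv (a := 2 * k + 1 + i) (by omega)
  have hc := qBinom_succ_right (2 * k) i
  have hd := qBinom_succ_right (2 * k + 1) i
  have hA : (1 - X ^ (2 * k + 1)) * qBinom (2 * k + 2) i * geomInv (2 * k + 1 + i)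
      = qBinom (2 * k + 1) i := by
    linear_combination geomInv (2 * k + 1 + i) * ha + qBinom (2 * k + 1) i * hw
  have hB : (1 - X ^ (2 * k + 1)) * qBinom (2 * k + 2) i * geomInv (i + 1)
      = qBinom (2 * k + 1) (i + 1) := by
    rw [hd]
    linear_combination geomInv (i + 1) * ha
  have hC : qBinom (2 * k + 1) (i + 1) - qBinom (2 * k + 1) i
      = X ^ (i + 1) * qBinom (2 * k) (i + 1) := by
    rw [hc, hd]
    have e : (X : ℚ⟦X⟧) ^ (2 * k + 1 + i) = X ^ (i + 1) * X ^ (2 * k) := by ring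
    rw [e]
    linear_combination qBinom (2 * k + 1) i * hv + X ^ (i + 1) * geomInv (i + 1) * hb
  unfold modeCoeff modeBoundary
  have e1 := choose_succ_two i
  have e2 := choose_succ_two (i + 1)
  rw [e2, e1, show 2 * (k + 1) = 2 * k + 2 by ring]
  generalize i.choose 2 = c
  generalize qBinom (2 * k) (i + 1) = z at *
  rw [← hB, ← hA] at hC
  rw [← hB, ← hA]
  linear_combination X ^ ((p + l) * (k * (i + 1) + (i + c)) + (i + c)) *
    X ^ ((k + 1 + i) * p) * hC

lemma modeCoeff_mul_sum_mode (N k i l : ℕ) (hl : l ≤ N) :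
    (1 - X ^ (2 * k + 1)) * modeCoeff N (k + 1) i *
      ∑ j ∈ range (N + 1), tentKernel ((X : ℚ⟦X⟧) ^ k) N l j * mode N (k + 1) i j =
    modeCoeff N k (i + 1) * mode N k (i + 1) l + modeBoundary N k i * endMode N k i l
      - modeBoundary N k (i + 1) * endMode N k (i + 1) l := by
  unfold mode endMode
  by_cases h : Even i
  · have h' : ¬ Even (i + 1) := by rwa [Nat.even_add_one, not_not]
    simp only [if_pos h, if_neg h']
    exact modeCoeff_mul_sum N k i l hl
  · have h' : Even (i + 1) := by rwa [Nat.even_add_one]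
    simp only [if_neg h, if_pos h']
    have := modeCoeff_mul_sum N k i (N - l) (by omega)
    rw [Nat.sub_sub_self hl] at this
    rw [← this, ← Finset.sum_flip]
    congr 1
    refine sum_congr rfl fun j hj => ?_
    rw [mem_range] at hj
    rw [Nat.sub_sub_self (by omega)]
    congr 1
    rw [← tentKernel_reflect _ (by omega : N - l ≤ N) (by omega : j ≤ N), Nat.sub_sub_self hl]

/-- The iterated tent kernels, applied to `l ↦ X ^ (K l)` at the top level `K = k + d`. -/
noncomputable def tentChain (N : ℕ) : ℕ → ℕ → ℕ → ℚ⟦X⟧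
  | 0, k, l => X ^ (k * l)
  | d + 1, k, l => ∑ j ∈ range (N + 1), tentKernel (X ^ k) N l j * tentChain N d (k + 1) j

lemma X_pow_dvd_tentChain_sub (N d k l : ℕ) (hN : 0 < N) (hl : l ≤ N) :
    X ^ (k + d) ∣ (∏ t ∈ range d, (1 - X ^ (2 * (k + t) + 1))) * tentChain N d k l
      - ∑ i ∈ range (d + 1), modeCoeff N k i * mode N k i l := by
  induction d generalizing k l with
  | zero => simp [tentChain, modeCoeff, mode]
  | succ d ih =>
    have hT : ∑ i ∈ range (d + 2), modeCoeff N k i * mode N k i l =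
        (1 - X ^ (2 * k + 1)) * ∑ j ∈ range (N + 1), tentKernel ((X : ℚ⟦X⟧) ^ k) N l j *
          ∑ i ∈ range (d + 1), modeCoeff N (k + 1) i * mode N (k + 1) i j
        + modeBoundary N k (d + 1) * endMode N k (d + 1) l := by
      have h0 : ∑ i ∈ range (d + 1), (modeBoundary N k i * endMode N k i l
          - modeBoundary N k (i + 1) * endMode N k (i + 1) l)
          = modeBoundary N k 0 * endMode N k 0 l
            - modeBoundary N k (d + 1) * endMode N k (d + 1) l :=
        Finset.sum_range_sub' (fun i => modeBoundary N k i * endMode N k i l) (d + 1)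
      have h1 : modeBoundary N k 0 * endMode N k 0 l = modeCoeff N k 0 * mode N k 0 l := by
        simp [modeBoundary, endMode, modeCoeff, mode]
      have h2 := sum_congr (rfl : range (d + 1) = range (d + 1))
        fun i _ => modeCoeff_mul_sum_mode N k i l hl
      simp only [add_sub_assoc] at h2
      rw [sum_add_distrib, h0, h1] at h2
      rw [sum_range_succ']
      simp only [mul_sum] at h2 ⊢
      rw [sum_comm] at h2
      have h3 : ∀ j i, (1 - X ^ (2 * k + 1)) * (tentKernel ((X : ℚ⟦X⟧) ^ k) N l j *
          (modeCoeff N (k + 1) i * mode N (k + 1) i j)) =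
          (1 - X ^ (2 * k + 1)) * modeCoeff N (k + 1) i *
            (tentKernel ((X : ℚ⟦X⟧) ^ k) N l j * mode N (k + 1) i j) := fun j i => by ring
      simp only [h3]
      rw [h2]
      ring
    rw [hT, tentChain, prod_range_succ']
    have hB : X ^ (k + (d + 1)) ∣ modeBoundary N k (d + 1) := by
      unfold modeBoundary
      refine dvd_mul_of_dvd_left (pow_dvd_pow _ ?_) _
      have e := choose_succ_two (d + 1)
      have h1 : k + (d + 1) ≤ k * (d + 1) + (d + 1 + 1).choose 2 := by
        rw [e]; nlinarith
      have h2 := Nat.le_mul_of_pos_left (k * (d + 1) + (d + 1 + 1).choose 2) hN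
      omega
    have hS : X ^ (k + (d + 1)) ∣ ∑ j ∈ range (N + 1), (1 - X ^ (2 * k + 1)) *
        tentKernel ((X : ℚ⟦X⟧) ^ k) N l j *
        ((∏ t ∈ range d, (1 - X ^ (2 * (k + 1 + t) + 1))) * tentChain N d (k + 1) j
          - ∑ i ∈ range (d + 1), modeCoeff N (k + 1) i * mode N (k + 1) i j) := by
      refine dvd_sum fun j hj => dvd_mul_of_dvd_right ?_ _
      rw [mem_range] at hj
      have := ih (k + 1) j (by omega)
      rwa [show k + 1 + d = k + (d + 1) by ring] at this
    have := dvd_sub hS (dvd_mul_of_dvd_left hB (endMode N k (d + 1) l))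
    convert this using 1
    have hP : ∏ t ∈ range d, (1 - (X : ℚ⟦X⟧) ^ (2 * (k + (t + 1)) + 1)) =
        ∏ t ∈ range d, (1 - X ^ (2 * (k + 1 + t) + 1)) :=
      prod_congr rfl fun t _ => by rw [add_right_comm, add_assoc]
    rw [hP, add_zero, ← sub_sub]
    congr 1
    simp only [mul_sum, ← sum_sub_distrib]
    refine sum_congr rfl fun j _ => ?_
    simp only [mul_sub, mul_sum]
    ring_nf

lemma X_pow_dvd_sum_tentChain_sub_one (N d : ℕ) (hN : 0 < N) :
    X ^ (d + 1) ∣ (∏ t ∈ range (d + 1), (1 - (X : ℚ⟦X⟧) ^ (2 * t + 1))) *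
      ∑ j ∈ range (N + 1), tentChain N d 1 j - 1 := by
  have h := X_pow_dvd_tentChain_sub N (d + 1) 0 0 hN (Nat.zero_le _)
  have h1 : ∑ i ∈ range (d + 1 + 1), modeCoeff N 0 i * mode N 0 i 0 = 1 := by
    rw [sum_range_succ']
    have : ∀ i, qBinom 0 (i + 1) = 0 := fun i => by
      rw [qBinom, prod_range_succ']; simp
    simp [modeCoeff, mode, this]
  rw [h1] at h
  simpa [tentChain, tentKernel] using h

/-- The theta polynomial `∑ (-1) ^ j q ^ ((N + 1) j (j - 1) / 2 + j s)`, summed over `-d ≤ j ≤ d`,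
written with `j = t + 1` and `j = - (t + 1)` paired. -/
noncomputable def thetaSum (N d s : ℕ) : ℚ⟦X⟧ :=
  1 - ∑ t ∈ range d, (-1) ^ t * X ^ ((N + 1) * (t + 1).choose 2) *
    (X ^ ((t + 1) * s) + X ^ ((t + 1) * (N + 1 - s)))

lemma sum_modeCoeff_sub (N t i : ℕ) (hi : i < N) :
    (1 - X) * ∑ l ∈ range (i + 1), modeCoeff N 1 t * (mode N 1 t l - mode N 1 t (N - l)) =
      (-1) ^ t * X ^ ((N + 1) * (t + 1).choose 2) * (1 + X ^ ((t + 1) * (N + 1)) -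
        (X ^ ((t + 1) * (i + 1)) + X ^ ((t + 1) * (N + 1 - (i + 1))))) := by
  have hm : ∀ l ∈ range (i + 1), modeCoeff N 1 t * (mode N 1 t l - mode N 1 t (N - l)) =
      modeCoeff N 1 t * (-1) ^ t * (X ^ ((t + 1) * l) - X ^ ((t + 1) * (N - l))) := by
    intro l hl
    rw [mem_range] at hl
    have : N - (N - l) = l := by omega
    unfold mode
    rcases Nat.even_or_odd t with h | h
    · rw [if_pos h, if_pos h, h.neg_one_pow]; ring
    · rw [if_neg (Nat.not_even_iff_odd.2 h), if_neg (Nat.not_even_iff_odd.2 h), h.neg_one_pow,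
        this]
      ring
  rw [sum_congr rfl hm, ← mul_sum, sum_sub_distrib]
  have h1 := sum_X_pow_mul (t + 1) (i + 1) (by omega)
  have h2 : ∑ l ∈ range (i + 1), (X : ℚ⟦X⟧) ^ ((t + 1) * (N - l)) =
      X ^ ((t + 1) * (N - i)) * ((1 - X ^ ((t + 1) * (i + 1))) * geomInv (t + 1)) := by
    rw [← h1, ← Finset.sum_flip, mul_sum]
    refine sum_congr rfl fun l hl => ?_
    rw [mem_range] at hl
    rw [← pow_add, ← mul_add]
    congr 2
    omega
  rw [h1, h2]
  have hq : (1 - X) * qBinom (2 * 1) t = 1 - X ^ (t + 1) := by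
    have := qBinom_succ_left 1 t
    have h' : qBinom 1 t = 1 := by
      refine prod_eq_one fun s _ => ?_
      rw [add_comm 1 s]
      exact one_sub_mul_geomInv (by omega)
    rw [h'] at this
    rw [mul_comm, add_comm t 1]
    simpa using this
  have hv := one_sub_mul_geomInv (a := t + 1) (by omega)
  obtain ⟨p, rfl⟩ : ∃ p, N = i + p := ⟨N - i, by omega⟩
  unfold modeCoeff
  have e : 1 * t + t.choose 2 = (t + 1).choose 2 := by rw [choose_succ_two]; ring
  rw [e, show i + p - i = p by omega, show i + p + 1 - (i + 1) = p by omega]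
  generalize (t + 1).choose 2 = c
  have hqv : (1 - X) * qBinom (2 * 1) t * geomInv (t + 1) = 1 := by rw [hq, hv]
  linear_combination X ^ ((i + p) * c + c) * (-1) ^ t * (1 - X ^ ((t + 1) * (i + 1))) *
    (1 - X ^ ((t + 1) * p)) * hqv

lemma X_pow_dvd_sum_tentChain_sub_thetaSum (N d i : ℕ) (hi : i < N) :
    X ^ (d + 1) ∣ (∏ t ∈ range (d + 1), (1 - (X : ℚ⟦X⟧) ^ (2 * t + 1))) *
      ∑ l ∈ range (i + 1), (tentChain N d 1 l - tentChain N d 1 (N - l))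
        - thetaSum N (d + 1) (i + 1) := by
  have hsum : (1 - X) * ∑ l ∈ range (i + 1), ∑ t ∈ range (d + 1),
        modeCoeff N 1 t * (mode N 1 t l - mode N 1 t (N - l)) =
      thetaSum N (d + 1) (i + 1) + (-1) ^ d * X ^ ((N + 1) * (d + 2).choose 2) := by
    rw [sum_comm, mul_sum, sum_congr rfl fun t _ => sum_modeCoeff_sub N t i hi]
    unfold thetaSum
    induction d with
    | zero => simp; ring
    | succ d ih =>
      rw [sum_range_succ, ih, sum_range_succ _ (d + 1), choose_succ_two (d + 2)]
      ring
  have hd : X ^ (d + 1) ∣ (-1) ^ d * (X : ℚ⟦X⟧) ^ ((N + 1) * (d + 2).choose 2) := by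
    refine dvd_mul_of_dvd_right (pow_dvd_pow _ ?_) _
    have e := choose_succ_two (d + 1)
    nlinarith
  have hS : X ^ (d + 1) ∣ ∑ l ∈ range (i + 1), (1 - X) *
      (((∏ t ∈ range d, (1 - X ^ (2 * (1 + t) + 1))) * tentChain N d 1 l
        - ∑ t ∈ range (d + 1), modeCoeff N 1 t * mode N 1 t l) -
      ((∏ t ∈ range d, (1 - X ^ (2 * (1 + t) + 1))) * tentChain N d 1 (N - l)
        - ∑ t ∈ range (d + 1), modeCoeff N 1 t * mode N 1 t (N - l))) := by
    refine dvd_sum fun l hl => dvd_mul_of_dvd_right ?_ _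
    rw [mem_range] at hl
    have h := dvd_sub (X_pow_dvd_tentChain_sub N d 1 l (by omega) (by omega))
      (X_pow_dvd_tentChain_sub N d 1 (N - l) (by omega) (by omega))
    rwa [add_comm 1 d] at h
  have := dvd_add hS hd
  convert this using 1
  rw [eq_sub_of_add_eq hsum.symm, prod_range_succ']
  have hP : ∏ t ∈ range d, (1 - (X : ℚ⟦X⟧) ^ (2 * (t + 1) + 1)) =
        ∏ t ∈ range d, (1 - X ^ (2 * (1 + t) + 1)) :=
      prod_congr rfl fun t _ => by rw [add_comm t 1]
  rw [hP]
  simp only [mul_sum, sum_sub_distrib, mul_sub]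
  ring_nf

/-- The weight with which the level pair `(a, b)` contributes to `(l, r)` in one step of the
transfer recursion for Meurman–Primc partitions. -/
def stepKernel {R : Type*} [CommRing R] (x : R) (N l r a b : ℕ) : R :=
  x ^ (l + a + r + b) - x ^ (l + a + r + b + 2 * (N - (max l a + max r b)))

lemma stepKernel_eq_zero {R : Type*} [CommRing R] (x : R) {N l r a b : ℕ}
    (h : N ≤ max l a + max r b) : stepKernel x N l r a b = 0 := by
  rw [stepKernel, Nat.sub_eq_zero_of_le h]; simp

lemma tentExponent_add_of_le {N l r a b : ℕ} (hlr : l + r < N) (hab : a + b < N)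
    (h : N ≤ max l a + max r b) :
    min (l + b) (2 * N - l - b) + min (r + a) (2 * N - r - a) =
      min (N - l + a) (2 * N - (N - l) - a) + min (N - r + b) (2 * N - (N - r) - b) := by
  have direct : ∀ {u c : ℕ}, u ≤ N → c ≤ N →
      (u + c ≤ N ∧ min (u + c) (2 * N - u - c) = u + c) ∨
      (N < u + c ∧ min (u + c) (2 * N - u - c) + u + c = 2 * N) := by omega
  have reflected : ∀ {u c : ℕ}, u ≤ N → c ≤ N →
      (u ≤ c ∧ min (N - u + c) (2 * N - (N - u) - c) + c = N + u) ∨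
      (c < u ∧ min (N - u + c) (2 * N - (N - u) - c) + u = N + c) := by omega
  have s1 := direct (u := l) (c := b) (by omega) (by omega)
  have s2 := direct (u := r) (c := a) (by omega) (by omega)
  have s3 := reflected (u := l) (c := a) (by omega) (by omega)
  have s4 := reflected (u := r) (c := b) (by omega) (by omega)
  clear direct reflected
  generalize min (l + b) (2 * N - l - b) = m1 at *
  generalize min (r + a) (2 * N - r - a) = m2 at *
  generalize min (N - l + a) (2 * N - (N - l) - a) = m3 at *
  generalize min (N - r + b) (2 * N - (N - r) - b) = m4 at *
  rcases s1 with s1 | s1 <;> rcases s2 with s2 | s2 <;> rcases s3 with s3 | s3 <;>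
    rcases s4 with s4 | s4 <;> omega

lemma tentExponent_add_of_lt {N l r a b : ℕ} (h : max l b + max r a < N) :
    min (l + a) (2 * N - l - a) + min (r + b) (2 * N - r - b) = l + a + r + b := by
  rw [min_eq_left (by omega), min_eq_left (by omega)]
  ring

lemma tentExponent_reflect_add_of_lt {N l r a b : ℕ} (h : max l a + max r b < N) :
    min (N - l + a) (2 * N - (N - l) - a) + min (N - r + b) (2 * N - (N - r) - b) =
      l + a + r + b + 2 * (N - (max l a + max r b)) := by
  omega

section

variable {R : Type*} [CommRing R] (x : R) {N l r a b : ℕ}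

lemma stepKernel_add_swap_of_lt (hlr : l + r < N) (hab : a + b < N) :
    stepKernel x N l r a b + stepKernel x N l r b a =
      (tentKernel x N l a * tentKernel x N r b
        - tentKernel x N (N - l) a * tentKernel x N (N - r) b)
      + (tentKernel x N l b * tentKernel x N r a
        - tentKernel x N (N - l) b * tentKernel x N (N - r) a) := by
  simp only [tentKernel, ← pow_add]
  rcases le_or_gt N (max l a + max r b) with h1 | h1 <;>
    rcases le_or_gt N (max l b + max r a) with h2 | h2
  · rw [stepKernel_eq_zero x h1, stepKernel_eq_zero x h2, tentExponent_add_of_le hlr hab h1,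
      tentExponent_add_of_le hlr (add_comm a b ▸ hab) h2]
    ring
  · rw [stepKernel_eq_zero x h1, stepKernel, tentExponent_add_of_le hlr hab h1,
      tentExponent_add_of_lt h2, tentExponent_reflect_add_of_lt h2]
    ring
  · rw [stepKernel_eq_zero x h2, stepKernel, tentExponent_add_of_lt h1,
      tentExponent_add_of_le hlr (add_comm a b ▸ hab) h2, tentExponent_reflect_add_of_lt h1]
    ring
  · rw [stepKernel, stepKernel, tentExponent_add_of_lt h1, tentExponent_add_of_lt h2,
      tentExponent_reflect_add_of_lt h1, tentExponent_reflect_add_of_lt h2]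

lemma stepKernel_antisymm (hlr : l + r < N) (ha : a ≤ N) (hb : b ≤ N) :
    stepKernel x N l r a b - stepKernel x N l r (N - a) (N - b)
        + (stepKernel x N l r b a - stepKernel x N l r (N - b) (N - a)) =
      (tentKernel x N l a * tentKernel x N r b
        - tentKernel x N (N - l) a * tentKernel x N (N - r) b)
      + (tentKernel x N l b * tentKernel x N r a
        - tentKernel x N (N - l) b * tentKernel x N (N - r) a) := by
  have hl : l ≤ N := by omega
  have hr : r ≤ N := by omega
  have reflect : ∀ {u c : ℕ}, u ≤ N → c ≤ N →
      tentKernel x N (N - u) c = tentKernel x N u (N - c) := fun {u c} hu hc => by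
    rw [← tentKernel_reflect x hu (Nat.sub_le N c), Nat.sub_sub_self hc]
  rcases lt_trichotomy (a + b) N with h | h | h
  · rw [← stepKernel_add_swap_of_lt x hlr h,
      stepKernel_eq_zero x (a := N - a) (b := N - b) (by omega),
      stepKernel_eq_zero x (a := N - b) (b := N - a) (by omega)]
    ring
  · obtain rfl : b = N - a := by omega
    rw [reflect hl ha, reflect hr hb, reflect hl hb, reflect hr ha, Nat.sub_sub_self ha]
    ring
  · have := stepKernel_add_swap_of_lt x hlr (a := N - a) (b := N - b) (by omega)
    rw [← reflect hl ha, ← reflect hr hb, ← reflect hl hb, ← reflect hr ha,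
      reflect hl (Nat.sub_le N a), reflect hl (Nat.sub_le N b), reflect hr (Nat.sub_le N a),
      reflect hr (Nat.sub_le N b), Nat.sub_sub_self ha, Nat.sub_sub_self hb] at this
    rw [stepKernel_eq_zero x (a := a) (b := b) (by omega),
      stepKernel_eq_zero x (a := b) (b := a) (by omega)]
    linear_combination -this

lemma sum_stepKernel_mul [IsAddTorsionFree R] (hlr : l + r < N) (e : ℕ → R) :
    ∑ a ∈ range (N + 1), ∑ b ∈ range (N + 1),
        stepKernel x N l r a b * (e a * e b - e (N - a) * e (N - b)) =
      (∑ a ∈ range (N + 1), tentKernel x N l a * e a)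
          * (∑ a ∈ range (N + 1), tentKernel x N r a * e a)
        - (∑ a ∈ range (N + 1), tentKernel x N (N - l) a * e a)
          * (∑ a ∈ range (N + 1), tentKernel x N (N - r) a * e a) := by
  have hflip : ∑ a ∈ range (N + 1), ∑ b ∈ range (N + 1),
        stepKernel x N l r a b * (e (N - a) * e (N - b)) =
      ∑ a ∈ range (N + 1), ∑ b ∈ range (N + 1),
        stepKernel x N l r (N - a) (N - b) * (e a * e b) := by
    rw [← Finset.sum_flip]
    refine sum_congr rfl fun a ha => ?_
    rw [← Finset.sum_flip]
    refine sum_congr rfl fun b hb => ?_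
    rw [mem_range] at ha hb
    rw [Nat.sub_sub_self (by omega), Nat.sub_sub_self (by omega)]
  set f : ℕ → ℕ → R := fun a b =>
    (stepKernel x N l r a b - stepKernel x N l r (N - a) (N - b)) * (e a * e b) with hf
  set g : ℕ → ℕ → R := fun a b => (tentKernel x N l a * tentKernel x N r b
    - tentKernel x N (N - l) a * tentKernel x N (N - r) b) * (e a * e b) with hg
  have hL : ∑ a ∈ range (N + 1), ∑ b ∈ range (N + 1),
        stepKernel x N l r a b * (e a * e b - e (N - a) * e (N - b)) =
      ∑ a ∈ range (N + 1), ∑ b ∈ range (N + 1), f a b := by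
    simp only [mul_sub, sum_sub_distrib, hf, sub_mul]
    rw [hflip]
  have hR : (∑ a ∈ range (N + 1), tentKernel x N l a * e a)
          * (∑ a ∈ range (N + 1), tentKernel x N r a * e a)
        - (∑ a ∈ range (N + 1), tentKernel x N (N - l) a * e a)
          * (∑ a ∈ range (N + 1), tentKernel x N (N - r) a * e a) =
      ∑ a ∈ range (N + 1), ∑ b ∈ range (N + 1), g a b := by
    simp only [sum_mul_sum, ← sum_sub_distrib, hg]
    exact sum_congr rfl fun a _ => sum_congr rfl fun b _ => by ring
  rw [hL, hR]
  have hsymm : ∀ h : ℕ → ℕ → R, 2 • ∑ a ∈ range (N + 1), ∑ b ∈ range (N + 1), h a b =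
      ∑ a ∈ range (N + 1), ∑ b ∈ range (N + 1), (h a b + h b a) := fun h => by
    simp only [sum_add_distrib]
    rw [two_nsmul, sum_comm (f := fun a b => h b a)]
  have h2 : 2 • ∑ a ∈ range (N + 1), ∑ b ∈ range (N + 1), f a b =
      2 • ∑ a ∈ range (N + 1), ∑ b ∈ range (N + 1), g a b := by
    rw [hsymm, hsymm]
    refine sum_congr rfl fun a ha => sum_congr rfl fun b hb => ?_
    rw [mem_range] at ha hb
    have := stepKernel_antisymm x hlr (Nat.le_of_lt_succ ha) (Nat.le_of_lt_succ hb)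
    simp only [hf, hg]
    linear_combination (e a * e b) * this
  exact nsmul_right_injective two_ne_zero h2

end

/-- Generating function of the parts above level `k`, over `d` levels, given that the parts
`2 k - 1` and `2 k - 1` underlined occur `l` and `r` times. -/
noncomputable def transferSum (n : ℕ) : ℕ → ℕ → ℕ → ℕ → ℚ⟦X⟧
  | 0, _, l, r => if l = 0 ∧ r = 0 then 1 else 0
  | d + 1, k, l, r => ∑ a ∈ range (n + 1), ∑ b ∈ range (n + 1), ∑ c ∈ range (n + 1),
      if max l b + c + max a r ≤ n then
        X ^ (2 * k * c + (2 * k + 1) * (a + b)) * transferSum n d (k + 1) a b else 0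

lemma one_sub_mul_sum_ite (n k s : ℕ) :
    (1 - X ^ (2 * k)) * ∑ c ∈ range (n + 1), (if s + c ≤ n then (X : ℚ⟦X⟧) ^ (2 * k * c) else 0) =
      1 - X ^ (2 * k * (n + 1 - s)) := by
  rw [← sum_filter]
  have : (range (n + 1)).filter (fun c => s + c ≤ n) = range (n + 1 - s) := by
    ext c; simp only [mem_filter, mem_range]; omega
  rw [this]
  have h := geom_sum_mul_neg ((X : ℚ⟦X⟧) ^ (2 * k)) (n + 1 - s)
  simp only [← pow_mul] at h
  rw [← h]; ring

lemma one_sub_mul_transferSum_succ (n d k l r : ℕ) :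
    (1 - X ^ (2 * k)) * X ^ (k * (l + r)) * transferSum n (d + 1) k l r =
      ∑ a ∈ range (n + 1), ∑ b ∈ range (n + 1), stepKernel ((X : ℚ⟦X⟧) ^ k) (n + 1) l r b a *
        (X ^ ((k + 1) * (a + b)) * transferSum n d (k + 1) a b) := by
  rw [transferSum, mul_sum]
  refine sum_congr rfl fun a _ => ?_
  rw [mul_sum]
  refine sum_congr rfl fun b _ => ?_
  have h := one_sub_mul_sum_ite n k (max l b + max a r)
  have h1 : ∑ c ∈ range (n + 1), (if max l b + c + max a r ≤ n then
        X ^ (2 * k * c + (2 * k + 1) * (a + b)) * transferSum n d (k + 1) a b else 0) =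
      (∑ c ∈ range (n + 1), if max l b + max a r + c ≤ n then (X : ℚ⟦X⟧) ^ (2 * k * c) else 0) *
        (X ^ ((2 * k + 1) * (a + b)) * transferSum n d (k + 1) a b) := by
    rw [sum_mul]
    refine sum_congr rfl fun c _ => ?_
    rw [show max l b + c + max a r = max l b + max a r + c by ring, ite_mul, zero_mul]
    congr 1
    ring
  rw [h1, stepKernel, max_comm r a]
  generalize n + 1 - (max l b + max a r) = s at *
  linear_combination X ^ (k * (l + r)) * X ^ ((2 * k + 1) * (a + b)) *
    transferSum n d (k + 1) a b * h

lemma prod_mul_transferSum (n d k l r : ℕ) (hlr : l + r ≤ n) :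
    (∏ t ∈ range (d + 1), (1 - X ^ (2 * (k + t)))) * X ^ (k * (l + r)) *
        transferSum n (d + 1) k l r =
      tentChain (n + 1) d k l * tentChain (n + 1) d k r
        - tentChain (n + 1) d k (n + 1 - l) * tentChain (n + 1) d k (n + 1 - r) := by
  induction d generalizing k l r with
  | zero =>
    have h := one_sub_mul_transferSum_succ n 0 k l r
    rw [zero_add, prod_range_one, add_zero, h]
    rw [sum_eq_single_of_mem 0 (by simp), sum_eq_single_of_mem 0 (by simp)]
    · simp only [transferSum, stepKernel, tentChain]
      obtain ⟨p, rfl⟩ : ∃ p, n = l + r + p := ⟨n - (l + r), by omega⟩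
      rw [show l + r + p + 1 - (max l 0 + max r 0) = p + 1 by simp; omega,
        show l + r + p + 1 - l = r + p + 1 by omega, show l + r + p + 1 - r = l + p + 1 by omega]
      simp
      ring
    · intro b _ hb
      simp [transferSum, hb]
    · intro a _ ha
      simp [transferSum, ha]
  | succ d ih =>
    have h := one_sub_mul_transferSum_succ n (d + 1) k l r
    have : IsAddTorsionFree ℚ⟦X⟧ := IsAddTorsionFree.of_module_rat _
    have hs := sum_stepKernel_mul ((X : ℚ⟦X⟧) ^ k) (N := n + 1) (l := l) (r := r) (by omega)
      (tentChain (n + 1) d (k + 1))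
    simp only [tentChain]
    rw [← hs, prod_range_succ', add_zero, sum_range_succ, sum_comm]
    have hz : ∑ b ∈ range (n + 1 + 1), stepKernel ((X : ℚ⟦X⟧) ^ k) (n + 1) l r (n + 1) b *
        (tentChain (n + 1) d (k + 1) (n + 1) * tentChain (n + 1) d (k + 1) b -
          tentChain (n + 1) d (k + 1) (n + 1 - (n + 1)) *
            tentChain (n + 1) d (k + 1) (n + 1 - b)) = 0 := by
      refine sum_eq_zero fun b _ => ?_
      rw [stepKernel_eq_zero _ (by omega), zero_mul]
    rw [hz, add_zero, sum_range_succ]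
    have hz' : ∑ a ∈ range (n + 1), stepKernel ((X : ℚ⟦X⟧) ^ k) (n + 1) l r a (n + 1) *
        (tentChain (n + 1) d (k + 1) a * tentChain (n + 1) d (k + 1) (n + 1) -
          tentChain (n + 1) d (k + 1) (n + 1 - a) *
            tentChain (n + 1) d (k + 1) (n + 1 - (n + 1))) = 0 := by
      refine sum_eq_zero fun b _ => ?_
      rw [stepKernel_eq_zero _ (by omega), zero_mul]
    rw [hz', add_zero, mul_assoc, mul_assoc, ← mul_assoc (1 - X ^ (2 * k)), h, mul_sum]
    refine sum_congr rfl fun a _ => ?_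
    rw [mul_sum]
    refine sum_congr rfl fun b _ => ?_
    rcases le_or_gt (a + b) n with hab | hab
    · have := ih (k + 1) a b hab
      have hP : ∏ t ∈ range (d + 1), (1 - (X : ℚ⟦X⟧) ^ (2 * (k + (t + 1)))) =
        ∏ t ∈ range (d + 1), (1 - X ^ (2 * (k + 1 + t))) :=
        prod_congr rfl fun t _ => by rw [add_right_comm, add_assoc]
      rw [hP]
      linear_combination stepKernel ((X : ℚ⟦X⟧) ^ k) (n + 1) l r b a * this
    · rw [stepKernel_eq_zero _ (by omega)]
      ring

/-- The generating function of Meurman–Primc partitions with parts at most `2 K`. -/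
noncomputable def mpSum (n i K : ℕ) : ℚ⟦X⟧ :=
  ∑ a ∈ range (n - i + 1), ∑ b ∈ range (i + 1), X ^ (a + b) * transferSum n K 1 a b

lemma prod_mul_mpSum (n i d : ℕ) (hi : i ≤ n) :
    (∏ t ∈ range (d + 1), (1 - X ^ (2 * (1 + t)))) * mpSum n i (d + 1) =
      (∑ j ∈ range (n + 2), tentChain (n + 1) d 1 j) *
        ∑ l ∈ range (i + 1), (tentChain (n + 1) d 1 l - tentChain (n + 1) d 1 (n + 1 - l)) := by
  set e := tentChain (n + 1) d 1 with he
  have h1 : (∏ t ∈ range (d + 1), (1 - X ^ (2 * (1 + t)))) * mpSum n i (d + 1) =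
      ∑ a ∈ range (n - i + 1), ∑ b ∈ range (i + 1),
        (e a * e b - e (n + 1 - a) * e (n + 1 - b)) := by
    rw [mpSum, mul_sum]
    refine sum_congr rfl fun a ha => ?_
    rw [mul_sum]
    refine sum_congr rfl fun b hb => ?_
    rw [mem_range] at ha hb
    have := prod_mul_transferSum n d 1 a b (by omega)
    rw [← this]
    ring
  have h2 : ∑ a ∈ range (n - i + 1), e (n + 1 - a) + ∑ a ∈ range (i + 1), e a =
      ∑ j ∈ range (n + 2), e j := by
    rw [show n + 2 = i + 1 + (n - i + 1) by omega, sum_range_add _ (i + 1), add_comm]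
    congr 1
    rw [← Finset.sum_flip]
    refine sum_congr rfl fun a ha => ?_
    rw [mem_range] at ha
    congr 1
    omega
  have h3 : ∑ a ∈ range (n - i + 1), e a + ∑ a ∈ range (i + 1), e (n + 1 - a) =
      ∑ j ∈ range (n + 2), e j := by
    rw [show n + 2 = n - i + 1 + (i + 1) by omega, sum_range_add _ (n - i + 1)]
    congr 1
    rw [← Finset.sum_flip]
    refine sum_congr rfl fun a ha => ?_
    rw [mem_range] at ha
    congr 1
    omega
  rw [h1]
  simp only [sum_sub_distrib, ← sum_mul_sum]
  linear_combination (∑ a ∈ range (i + 1), e a) * h3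
    - (∑ a ∈ range (i + 1), e (n + 1 - a)) * h2

/-- The normalising product relating `mpSum` to the theta polynomial. -/
noncomputable def mpFactor (d : ℕ) : ℚ⟦X⟧ :=
  (∏ t ∈ range (d + 1), (1 - X ^ (2 * (1 + t)))) *
    (∏ t ∈ range (d + 1), (1 - X ^ (2 * t + 1))) ^ 2

lemma X_pow_dvd_mpFactor_mul_mpSum (n i d : ℕ) (hi : i ≤ n) :
    X ^ (d + 1) ∣ mpFactor d * mpSum n i (d + 1) - thetaSum (n + 1) (d + 1) (i + 1) := by
  have h1 := X_pow_dvd_sum_tentChain_sub_one (n + 1) d (by omega)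
  have h2 := X_pow_dvd_sum_tentChain_sub_thetaSum (n + 1) d i (by omega)
  have h := prod_mul_mpSum n i d hi
  obtain ⟨u, hu⟩ := h1
  obtain ⟨w, hw⟩ := h2
  refine ⟨u * ((∏ t ∈ range (d + 1), (1 - X ^ (2 * t + 1))) * ∑ l ∈ range (i + 1),
    (tentChain (n + 1) d 1 l - tentChain (n + 1) d 1 (n + 1 - l))) + w, ?_⟩
  unfold mpFactor
  linear_combination (∏ t ∈ range (d + 1), (1 - (X : ℚ⟦X⟧) ^ (2 * t + 1))) ^ 2 * h +
    ((∏ t ∈ range (d + 1), (1 - X ^ (2 * t + 1))) * ∑ l ∈ range (i + 1),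
    (tentChain (n + 1) d 1 l - tentChain (n + 1) d 1 (n + 1 - l))) * hu + hw

/-- Generating function of the colour sequences of length `M` preceded by the colour `i`, a step
between the colours `u` and `u'` at distance `k` from the top having weight `k * |u - u'|`. -/
noncomputable def colorSum (n : ℕ) : ℕ → ℕ → ℚ⟦X⟧
  | 0, _ => 1
  | M + 1, i => ∑ u ∈ range (n + 1), X ^ ((M + 1) * (u - i + (i - u))) * colorSum n M u

/-- The symmetric exponential mode on `{0, …, n}`. -/
noncomputable def symMode (n j i : ℕ) : ℚ⟦X⟧ := X ^ (j * (i + 1)) + X ^ (j * (n + 1 - i))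

lemma sum_X_pow_dist_mul_X_pow (n j e i : ℕ) (he : 0 < e) (hi : i ≤ n) :
    ∑ u ∈ range (n + 1), (X : ℚ⟦X⟧) ^ ((j + e) * (u - i + (i - u))) * X ^ (j * (u + 1)) =
      X ^ (j * (i + 1)) * (geomInv e + X ^ (2 * j + e) * geomInv (2 * j + e))
        - geomInv e * X ^ ((j + e) * (i + 1))
        - geomInv (2 * j + e) * X ^ (j * (n + 2)) * X ^ ((j + e) * (n + 1 - i)) := by
  obtain ⟨p, rfl⟩ : ∃ p, n = i + p := ⟨n - i, by omega⟩
  rw [show i + p + 1 = (i + 1) + p by ring, sum_range_add]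
  have h1 : ∑ u ∈ range (i + 1), (X : ℚ⟦X⟧) ^ ((j + e) * (u - i + (i - u))) * X ^ (j * (u + 1)) =
      X ^ (j * (i + 1)) * ((1 - X ^ (e * (i + 1))) * geomInv e) := by
    rw [← sum_X_pow_mul _ _ he, mul_sum, ← Finset.sum_flip]
    refine sum_congr rfl fun u hu => ?_
    rw [mem_range] at hu
    obtain ⟨t, rfl⟩ : ∃ t, i = u + t := ⟨i - u, by omega⟩
    rw [← pow_add, ← pow_add, show u + t - u - (u + t) + (u + t - (u + t - u)) = u by omega,
      show u + t - u = t by omega]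
    ring_nf
  have h2 : ∑ u ∈ range p, (X : ℚ⟦X⟧) ^ ((j + e) * (i + 1 + u - i + (i - (i + 1 + u)))) *
        X ^ (j * (i + 1 + u + 1)) =
      X ^ (j * (i + 1) + (2 * j + e)) *
        ((1 - X ^ ((2 * j + e) * p)) * geomInv (2 * j + e)) := by
    rw [← sum_X_pow_mul _ _ (by omega), mul_sum]
    refine sum_congr rfl fun u _ => ?_
    rw [← pow_add, ← pow_add, show i + 1 + u - i + (i - (i + 1 + u)) = u + 1 by omega]
    ring_nf
  rw [h1, h2, show i + 1 + p - i = p + 1 by omega]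
  ring

lemma sum_X_pow_dist_mul_symMode (n j e i : ℕ) (he : 0 < e) (hi : i ≤ n) :
    ∑ u ∈ range (n + 1), (X : ℚ⟦X⟧) ^ ((j + e) * (u - i + (i - u))) * symMode n j u =
      (1 - X ^ (2 * (j + e))) * geomInv e * geomInv (2 * j + e) * symMode n j i
        - (geomInv e + X ^ (j * (n + 2)) * geomInv (2 * j + e)) * symMode n (j + e) i := by
  have h1 := sum_X_pow_dist_mul_X_pow n j e i he hi
  have h2 := sum_X_pow_dist_mul_X_pow n j e (n - i) he (by omega)
  have h3 : ∑ u ∈ range (n + 1), (X : ℚ⟦X⟧) ^ ((j + e) * (u - i + (i - u))) *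
        X ^ (j * (n + 1 - u)) =
      ∑ u ∈ range (n + 1), (X : ℚ⟦X⟧) ^ ((j + e) * (u - (n - i) + (n - i - u))) *
        X ^ (j * (u + 1)) := by
    rw [← Finset.sum_flip]
    refine sum_congr rfl fun u hu => ?_
    rw [mem_range] at hu
    congr 3 <;> omega
  rw [show n - i + 1 = n + 1 - i by omega, show n + 1 - (n - i) = i + 1 by omega] at h2
  have hv := one_sub_mul_geomInv he
  have hw := one_sub_mul_geomInv (a := 2 * j + e) (by omega)
  have hA : geomInv e + X ^ (2 * j + e) * geomInv (2 * j + e) =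
      (1 - X ^ (2 * (j + e))) * geomInv e * geomInv (2 * j + e) := by
    linear_combination (-geomInv e) * hw - X ^ (2 * j + e) * geomInv (2 * j + e) * hv
  rw [hA] at h1 h2
  have hsplit : ∑ u ∈ range (n + 1), (X : ℚ⟦X⟧) ^ ((j + e) * (u - i + (i - u))) * symMode n j u =
      ∑ u ∈ range (n + 1), X ^ ((j + e) * (u - i + (i - u))) * X ^ (j * (u + 1)) +
      ∑ u ∈ range (n + 1), X ^ ((j + e) * (u - i + (i - u))) * X ^ (j * (n + 1 - u)) := by
    simp only [symMode, ← sum_add_distrib, ← mul_add]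
  rw [hsplit, h3, h1, h2, symMode, symMode]
  ring

/-- The finite product `∏_{1 ≤ k ≤ n} (1 - X ^ k)`. -/
noncomputable def eulerProd (n : ℕ) : ℚ⟦X⟧ := ∏ t ∈ range n, (1 - X ^ (t + 1))

/-- The inverse of `eulerProd n`. -/
noncomputable def eulerProdInv (n : ℕ) : ℚ⟦X⟧ := ∏ t ∈ range n, geomInv (t + 1)

lemma eulerProd_mul_inv (n : ℕ) : eulerProd n * eulerProdInv n = 1 := by
  rw [eulerProd, eulerProdInv, ← prod_mul_distrib]
  exact prod_eq_one fun t _ => one_sub_mul_geomInv t.succ_pos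

lemma eulerProd_succ (n : ℕ) : eulerProd (n + 1) = eulerProd n * (1 - X ^ (n + 1)) :=
  prod_range_succ _ _

lemma eulerProdInv_succ (n : ℕ) : eulerProdInv (n + 1) = eulerProdInv n * geomInv (n + 1) :=
  prod_range_succ _ _

/-- The coefficient of the `j`-th symmetric mode after `M` steps. -/
noncomputable def symCoeff (M j : ℕ) : ℚ⟦X⟧ :=
  eulerProd M ^ 2 * eulerProdInv (M - j) * eulerProdInv (M + j)

lemma symCoeff_zero_right (M : ℕ) : symCoeff M 0 = 1 := by
  have h := eulerProd_mul_inv M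
  simp only [symCoeff, Nat.sub_zero, add_zero]
  linear_combination (eulerProd M * eulerProdInv M + 1) * h

lemma symCoeff_mul_geomInv (M j : ℕ) (hj : j < M) :
    symCoeff M j * geomInv (M + 1 + j) = symCoeff M (j + 1) * geomInv (M - j) := by
  obtain ⟨e, rfl⟩ : ∃ e, M = j + 1 + e := ⟨M - (j + 1), by omega⟩
  unfold symCoeff
  rw [show j + 1 + e - j = e + 1 by omega, show j + 1 + e - (j + 1) = e by omega,
    ← add_assoc, eulerProdInv_succ, eulerProdInv_succ,
    show j + 1 + e + 1 + j = j + 1 + e + j + 1 by ring]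
  ring

lemma symCoeff_mul_step (M j : ℕ) (hj : j ≤ M) :
    symCoeff M j * ((1 - X ^ (2 * (M + 1))) * geomInv (M + 1 - j) * geomInv (M + 1 + j)) =
      (1 + X ^ (M + 1)) * geomInv (M + 1) * symCoeff (M + 1) j := by
  have hv := one_sub_mul_geomInv (a := M + 1) (by omega)
  obtain ⟨e, rfl⟩ : ∃ e, M = j + e := ⟨M - j, by omega⟩
  unfold symCoeff
  rw [show j + e + 1 - j = e + 1 by omega, show j + e - j = e by omega,
    show j + e + 1 + j = j + e + j + 1 by ring, eulerProdInv_succ, eulerProdInv_succ,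
    eulerProd_succ]
  linear_combination -eulerProd (j + e) ^ 2 * eulerProdInv e * geomInv (e + 1) *
    eulerProdInv (j + e + j) * geomInv (j + e + j + 1) * (1 - X ^ (j + e + 1)) *
    (1 + X ^ (j + e + 1)) * hv

lemma symCoeff_self_mul_geomInv (M : ℕ) :
    symCoeff M M * geomInv (2 * M + 1) =
      (1 + X ^ (M + 1)) * geomInv (M + 1) * symCoeff (M + 1) (M + 1) := by
  have hv := one_sub_mul_geomInv (a := M + 1) (by omega)
  have hw := one_sub_mul_geomInv (a := 2 * M + 1 + 1) (by omega)
  unfold symCoeff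
  rw [Nat.sub_self, Nat.sub_self, show M + 1 + (M + 1) = 2 * M + 1 + 1 by ring, ← two_mul,
    eulerProdInv_succ (2 * M + 1), eulerProdInv_succ, eulerProd_succ]
  linear_combination -eulerProd M ^ 2 * eulerProdInv 0 * eulerProdInv (2 * M) *
    geomInv (2 * M + 1) * ((1 - X ^ (2 * M + 1 + 1)) * geomInv (2 * M + 1 + 1) * hv + hw)

/-- The closed form of `colorSum`, up to normalisation. -/
noncomputable def symSeries (n M i : ℕ) : ℚ⟦X⟧ :=
  1 - ∑ t ∈ range M, (-1) ^ t * X ^ ((n + 2) * (t + 1).choose 2) * symCoeff M (t + 1) *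
    symMode n (t + 1) i

lemma sum_symCoeff_telescope (n M s : ℕ) (hs : s ≤ M) :
    ∑ t ∈ range s, (-1) ^ t * X ^ ((n + 2) * (t + 1).choose 2) * symCoeff M (t + 1) *
        (geomInv (M - t) + X ^ ((t + 1) * (n + 2)) * geomInv (M + 1 + (t + 1))) =
      geomInv (M + 1) - (-1) ^ s * X ^ ((n + 2) * (s + 1).choose 2) * symCoeff M s *
        geomInv (M + 1 + s) := by
  induction s with
  | zero => simp [symCoeff_zero_right]
  | succ s ih =>
    rw [sum_range_succ, ih (by omega)]
    have h := symCoeff_mul_geomInv M s (by omega)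
    have e : (X : ℚ⟦X⟧) ^ ((n + 2) * (s + 1 + 1).choose 2) =
        X ^ ((n + 2) * (s + 1).choose 2) * X ^ ((s + 1) * (n + 2)) := by
      rw [choose_succ_two (s + 1)]; ring
    rw [e]
    linear_combination (-(-1) ^ s * X ^ ((n + 2) * (s + 1).choose 2)) * h

lemma sum_X_pow_dist_mul_symSeries (n M i : ℕ) (hi : i ≤ n) :
    ∑ u ∈ range (n + 1), (X : ℚ⟦X⟧) ^ ((M + 1) * (u - i + (i - u))) * symSeries n M u =
      (1 + X ^ (M + 1)) * geomInv (M + 1) * symSeries n (M + 1) i := by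
  have h0 := sum_X_pow_dist_mul_symMode n 0 (M + 1) i (by omega) hi
  have hone : ∀ u, symMode n 0 u = 2 := fun u => by simp [symMode]; norm_num
  have hv := one_sub_mul_geomInv (a := M + 1) (by omega)
  have h0' : ∑ u ∈ range (n + 1), (X : ℚ⟦X⟧) ^ ((M + 1) * (u - i + (i - u))) =
      (1 + X ^ (M + 1)) * geomInv (M + 1) - geomInv (M + 1) * symMode n (M + 1) i := by
    simp only [hone, ← sum_mul, zero_add, mul_zero, zero_mul, pow_zero, one_mul] at h0
    have h2 : (2 : ℚ⟦X⟧) ≠ 0 := by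
      intro h
      have := congrArg (PowerSeries.coeff 0) h
      rw [show (2 : ℚ⟦X⟧) = PowerSeries.C 2 from (map_ofNat _ 2).symm] at this
      simp at this
    apply mul_right_cancel₀ h2
    linear_combination h0 + 2 * (1 + X ^ (M + 1)) * geomInv (M + 1) * hv
  have h1 : ∀ t ∈ range M, ∑ u ∈ range (n + 1), (X : ℚ⟦X⟧) ^ ((M + 1) * (u - i + (i - u))) *
        ((-1) ^ t * X ^ ((n + 2) * (t + 1).choose 2) * symCoeff M (t + 1) * symMode n (t + 1) u) =
      (1 + X ^ (M + 1)) * geomInv (M + 1) * ((-1) ^ t * X ^ ((n + 2) * (t + 1).choose 2) *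
          symCoeff (M + 1) (t + 1) * symMode n (t + 1) i)
        - ((-1) ^ t * X ^ ((n + 2) * (t + 1).choose 2) * symCoeff M (t + 1) *
          (geomInv (M - t) + X ^ ((t + 1) * (n + 2)) * geomInv (M + 1 + (t + 1)))) *
          symMode n (M + 1) i := by
    intro t ht
    rw [mem_range] at ht
    have h := sum_X_pow_dist_mul_symMode n (t + 1) (M - t) i (by omega) hi
    have hs := symCoeff_mul_step M (t + 1) (by omega)
    rw [show t + 1 + (M - t) = M + 1 by omega,
      show 2 * (t + 1) + (M - t) = M + 1 + (t + 1) by omega] at h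
    rw [show M + 1 - (t + 1) = M - t by omega] at hs
    have hm : ∑ u ∈ range (n + 1), (X : ℚ⟦X⟧) ^ ((M + 1) * (u - i + (i - u))) *
        ((-1) ^ t * X ^ ((n + 2) * (t + 1).choose 2) * symCoeff M (t + 1) * symMode n (t + 1) u) =
      (-1) ^ t * X ^ ((n + 2) * (t + 1).choose 2) * symCoeff M (t + 1) *
        ∑ u ∈ range (n + 1), (X : ℚ⟦X⟧) ^ ((M + 1) * (u - i + (i - u))) *
          symMode n (t + 1) u := by
      rw [mul_sum]
      exact sum_congr rfl fun u _ => by ring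
    rw [hm, h]
    linear_combination (-1) ^ t * X ^ ((n + 2) * (t + 1).choose 2) * symMode n (t + 1) i * hs
  have htel := sum_symCoeff_telescope n M M le_rfl
  have hself := symCoeff_self_mul_geomInv M
  rw [show M + 1 + M = 2 * M + 1 by ring] at htel
  simp only [symSeries, mul_sub, mul_one, sum_sub_distrib]
  simp only [mul_sum]
  rw [sum_comm, sum_congr rfl h1, sum_sub_distrib, ← sum_mul, htel, h0', sum_range_succ]
  linear_combination (-(-1) ^ M * X ^ ((n + 2) * (M + 1).choose 2) * symMode n (M + 1) i) * hself

lemma colorSum_eq (n M i : ℕ) (hi : i ≤ n) :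
    colorSum n M i =
      (∏ t ∈ range M, ((1 + X ^ (t + 1)) * geomInv (t + 1))) * symSeries n M i := by
  induction M generalizing i with
  | zero => simp [colorSum, symSeries]
  | succ M ih =>
    rw [colorSum, prod_range_succ, mul_assoc, ← sum_X_pow_dist_mul_symSeries n M i hi, mul_sum]
    refine sum_congr rfl fun u hu => ?_
    rw [ih u (by rw [mem_range] at hu; omega)]
    ring

lemma dvd_prod_sub_one {R : Type*} [CommRing R] {ι : Type*} {x : R} {s : Finset ι} {f : ι → R}
    (h : ∀ t ∈ s, x ∣ f t - 1) : x ∣ ∏ t ∈ s, f t - 1 := by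
  classical
  induction s using Finset.induction_on with
  | empty => simp
  | insert a s ha ih =>
    rw [prod_insert ha]
    have h1 := h a (mem_insert_self a s)
    have h2 := ih fun t ht => h t (mem_insert_of_mem ht)
    have := dvd_add (dvd_mul_of_dvd_left h1 (∏ t ∈ s, f t)) h2
    convert this using 1
    ring

lemma X_pow_dvd_eulerProd_mul_sub_one (e j : ℕ) :
    X ^ (e + 1) ∣ eulerProd (e + j) * eulerProdInv e - 1 := by
  have h : eulerProd (e + j) * eulerProdInv e = ∏ t ∈ range j, (1 - X ^ (e + t + 1)) := by
    rw [eulerProd, prod_range_add, ← eulerProd]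
    linear_combination (∏ t ∈ range j, (1 - X ^ (e + t + 1))) * eulerProd_mul_inv e
  rw [h]
  refine dvd_prod_sub_one fun t _ => ?_
  rw [sub_sub_cancel_left]
  exact (pow_dvd_pow _ (by omega)).neg_right

lemma X_pow_dvd_symCoeff_sub_one (e j : ℕ) : X ^ (e + 1) ∣ symCoeff (e + j) j - 1 := by
  obtain ⟨u, hu⟩ := X_pow_dvd_eulerProd_mul_sub_one e j
  obtain ⟨w, hw⟩ := (pow_dvd_pow (X : ℚ⟦X⟧) (show e + 1 ≤ e + j + 1 by omega)).trans
    (X_pow_dvd_eulerProd_mul_sub_one (e + j) j)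
  have h1 := eulerProd_mul_inv (e + j)
  have h2 := eulerProd_mul_inv (e + j + j)
  refine ⟨u * (eulerProd (e + j) * eulerProdInv (e + j + j)) -
    (eulerProd (e + j) * eulerProdInv (e + j + j)) * w, ?_⟩
  unfold symCoeff
  rw [Nat.add_sub_cancel]
  linear_combination (eulerProd (e + j) * eulerProdInv (e + j + j)) * (hu - hw) +
    eulerProd (e + j + j) * eulerProdInv (e + j + j) * h1 + h2

lemma X_pow_dvd_symSeries_sub_thetaSum (n K i : ℕ) (hi : i ≤ n) :
    X ^ K ∣ symSeries n (2 * K) i - thetaSum (n + 1) K (i + 1) := by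
  have h : symSeries n (2 * K) i - thetaSum (n + 1) K (i + 1) =
      -(∑ t ∈ range K, (-1) ^ t * X ^ ((n + 2) * (t + 1).choose 2) *
        (symCoeff (2 * K) (t + 1) - 1) * symMode n (t + 1) i) -
      ∑ t ∈ range K, (-1) ^ (K + t) * X ^ ((n + 2) * (K + t + 1).choose 2) *
        symCoeff (2 * K) (K + t + 1) * symMode n (K + t + 1) i := by
    rw [symSeries, two_mul, sum_range_add, thetaSum]
    have : ∀ t, (X : ℚ⟦X⟧) ^ ((t + 1) * (i + 1)) + X ^ ((t + 1) * (n + 1 + 1 - (i + 1))) =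
        symMode n (t + 1) i := fun t => by
      rw [symMode, Nat.add_sub_add_right]
    simp only [this, mul_sub, sub_mul, mul_one, sum_sub_distrib]
    ring
  rw [h]
  refine dvd_sub (Dvd.dvd.neg_right (dvd_sum fun t ht => ?_)) (dvd_sum fun t _ => ?_)
  · rw [mem_range] at ht
    refine dvd_mul_of_dvd_left (dvd_mul_of_dvd_right ?_ _) _
    have := X_pow_dvd_symCoeff_sub_one (2 * K - (t + 1)) (t + 1)
    rw [Nat.sub_add_cancel (by omega)] at this
    exact (pow_dvd_pow _ (by omega)).trans this
  · refine dvd_mul_of_dvd_right ?_ _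
    refine dvd_add (pow_dvd_pow _ ?_) (pow_dvd_pow _ ?_)
    · nlinarith
    · have : 1 ≤ n + 1 - i := by omega
      nlinarith

lemma mpFactor_eq (d : ℕ) :
    mpFactor d = eulerProd (2 * (d + 1)) * ∏ t ∈ range (d + 1), (1 - X ^ (2 * t + 1)) := by
  have h : ∀ K : ℕ, (∏ t ∈ range K, (1 - (X : ℚ⟦X⟧) ^ (2 * (1 + t)))) *
      (∏ t ∈ range K, (1 - X ^ (2 * t + 1))) = eulerProd (2 * K) := by
    intro K
    induction K with
    | zero => simp [eulerProd]
    | succ K ih =>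
      rw [prod_range_succ, prod_range_succ, show 2 * (K + 1) = 2 * K + 1 + 1 by ring,
        eulerProd_succ, eulerProd_succ, ← ih, show 2 * (1 + K) = 2 * K + 1 + 1 by ring]
      ring
  rw [mpFactor, ← h]
  ring

lemma X_pow_dvd_prod_odd_mul_prod_one_add (K : ℕ) :
    X ^ K ∣ (∏ t ∈ range K, (1 - (X : ℚ⟦X⟧) ^ (2 * t + 1))) *
      (∏ t ∈ range (2 * K), (1 + X ^ (t + 1))) - 1 := by
  have h : ∀ K : ℕ, (∏ t ∈ range K, (1 - (X : ℚ⟦X⟧) ^ (2 * t + 1))) *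
      (∏ t ∈ range (2 * K), (1 + X ^ (t + 1))) = ∏ t ∈ range K, (1 - X ^ (2 * (K + t + 1))) := by
    intro K
    have h1 : ∀ L : ℕ, (∏ t ∈ range L, (1 - (X : ℚ⟦X⟧) ^ (2 * t + 1))) *
        (∏ t ∈ range L, (1 - X ^ (2 * (t + 1)))) = eulerProd (2 * L) := by
      intro L
      induction L with
      | zero => simp [eulerProd]
      | succ L ih =>
        rw [prod_range_succ, prod_range_succ, show 2 * (L + 1) = 2 * L + 1 + 1 by ring,
          eulerProd_succ, eulerProd_succ, ← ih]
        ring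
    have h2 : (∏ t ∈ range K, (1 - (X : ℚ⟦X⟧) ^ (2 * (t + 1)))) *
        (∏ t ∈ range K, (1 - X ^ (2 * (K + t + 1)))) =
        eulerProd (2 * K) * (∏ t ∈ range (2 * K), (1 + X ^ (t + 1))) := by
      rw [← prod_range_add (fun t => 1 - (X : ℚ⟦X⟧) ^ (2 * (t + 1))), ← two_mul, eulerProd,
        ← prod_mul_distrib]
      exact prod_congr rfl fun t _ => by ring
    have hne : (∏ t ∈ range K, (1 - (X : ℚ⟦X⟧) ^ (2 * (t + 1)))) ≠ 0 := by
      refine prod_ne_zero_iff.2 fun t _ h0 => ?_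
      have := one_sub_mul_geomInv (a := 2 * (t + 1)) (by omega)
      rw [h0, zero_mul] at this
      exact zero_ne_one this
    apply mul_left_cancel₀ hne
    rw [h2, ← h1]
    ring
  rw [h]
  refine dvd_prod_sub_one fun t _ => ?_
  rw [sub_sub_cancel_left]
  exact (pow_dvd_pow _ (by omega)).neg_right

lemma X_pow_dvd_colorSum_sub_mpSum (n i d : ℕ) (hi : i ≤ n) :
    X ^ (d + 1) ∣ colorSum n (2 * (d + 1)) i - mpSum n i (d + 1) := by
  have hu : IsUnit (mpFactor d) := by
    rw [PowerSeries.isUnit_iff_constantCoeff, mpFactor]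
    simp
  rw [← hu.dvd_mul_left, mul_sub]
  obtain ⟨a, ha⟩ := X_pow_dvd_mpFactor_mul_mpSum n i d hi
  obtain ⟨b, hb⟩ := X_pow_dvd_symSeries_sub_thetaSum n (d + 1) i hi
  obtain ⟨c, hc⟩ := X_pow_dvd_prod_odd_mul_prod_one_add (d + 1)
  have hE := eulerProd_mul_inv (2 * (d + 1))
  refine ⟨c * symSeries n (2 * (d + 1)) i + b - a, ?_⟩
  have : mpFactor d * colorSum n (2 * (d + 1)) i =
      ((∏ t ∈ range (d + 1), (1 - (X : ℚ⟦X⟧) ^ (2 * t + 1))) *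
      (∏ t ∈ range (2 * (d + 1)), (1 + X ^ (t + 1)))) * symSeries n (2 * (d + 1)) i := by
    rw [mpFactor_eq, colorSum_eq n _ i hi, prod_mul_distrib, ← eulerProdInv]
    linear_combination (∏ t ∈ range (d + 1), (1 - (X : ℚ⟦X⟧) ^ (2 * t + 1))) *
      (∏ t ∈ range (2 * (d + 1)), (1 + X ^ (t + 1))) * symSeries n (2 * (d + 1)) i * hE
  rw [this]
  linear_combination symSeries n (2 * (d + 1)) i * hc + hb - ha

/-- The weight of a colour sequence listed from the smallest part upwards, preceded by the
colour `i` of the part `0`. -/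
def colorWt : ℕ → List ℕ → ℕ
  | _, [] => 0
  | i, u :: w => (w.length + 1) * (u - i + (i - u)) + colorWt u w

/-- The colour sequences of length `M` with colours in `{0, …, n}`. -/
def colorLists (n : ℕ) : ℕ → Finset (List ℕ)
  | 0 => {[]}
  | M + 1 => (range (n + 1) ×ˢ colorLists n M).image fun p => p.1 :: p.2

lemma mem_colorLists {n M : ℕ} {w : List ℕ} :
    w ∈ colorLists n M ↔ w.length = M ∧ ∀ u ∈ w, u ≤ n := by
  induction M generalizing w with
  | zero =>
    simp only [colorLists, mem_singleton, List.length_eq_zero_iff]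
    constructor
    · rintro rfl; simp
    · exact fun h => h.1
  | succ M ih =>
    cases w with
    | nil => simp [colorLists]
    | cons u w =>
      simp only [colorLists, mem_image, mem_product, mem_range, Prod.exists, List.cons.injEq]
      constructor
      · rintro ⟨a, b, ⟨ha, hb⟩, rfl, rfl⟩
        rw [ih] at hb
        refine ⟨by simp [hb.1], ?_⟩
        simp only [List.mem_cons, forall_eq_or_imp]
        exact ⟨by omega, hb.2⟩
      · rintro ⟨h1, h2⟩
        simp only [List.mem_cons, forall_eq_or_imp] at h2
        exact ⟨u, w, ⟨by omega, ih.2 ⟨by simpa using h1, h2.2⟩⟩, rfl, rfl⟩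

lemma colorSum_eq_sum (n M i : ℕ) :
    colorSum n M i = ∑ w ∈ colorLists n M, X ^ colorWt i w := by
  induction M generalizing i with
  | zero => simp [colorSum, colorLists, colorWt]
  | succ M ih =>
    rw [colorSum, colorLists, sum_image (by
      rintro ⟨a, b⟩ _ ⟨c, d⟩ _ h
      simpa using h), sum_product]
    refine sum_congr rfl fun u _ => ?_
    rw [ih, mul_sum]
    refine sum_congr rfl fun w hw => ?_
    rw [colorWt, (mem_colorLists.1 hw).1, pow_add]

lemma coeff_sum_X_pow {α : Type*} (s : Finset α) (wt : α → ℕ) (m : ℕ) :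
    PowerSeries.coeff m (∑ w ∈ s, (X : ℚ⟦X⟧) ^ wt w) = ((s.filter fun w => wt w = m).card : ℚ) := by
  rw [map_sum, card_filter, Nat.cast_sum]
  refine sum_congr rfl fun w _ => ?_
  rw [coeff_X_pow]
  simp [eq_comm]

lemma colorWt_dropWhile (i : ℕ) (w : List ℕ) :
    colorWt i (w.dropWhile (· == i)) = colorWt i w := by
  induction w with
  | nil => rfl
  | cons u w ih =>
    by_cases h : u = i
    · subst h
      simp [colorWt, ih]
    · simp [h]

lemma replicate_append_dropWhile (i : ℕ) (w : List ℕ) :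
    List.replicate (w.length - (w.dropWhile (· == i)).length) i ++ w.dropWhile (· == i) = w := by
  induction w with
  | nil => rfl
  | cons u w ih =>
    by_cases h : u = i
    · subst h
      have : (w.dropWhile (· == u)).length ≤ w.length :=
        (List.dropWhile_suffix _).length_le
      simp only [List.dropWhile_cons, beq_self_eq_true, if_true, List.length_cons]
      rw [Nat.sub_add_comm this, List.replicate_succ, List.cons_append, ih]
    · simp [h]

lemma dropWhile_replicate_append (i k : ℕ) {w : List ℕ} (hw : w.head? ≠ some i) :
    (List.replicate k i ++ w).dropWhile (· == i) = w := by
  induction k with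
  | zero =>
    cases w with
    | nil => rfl
    | cons u w =>
      have : u ≠ i := by simpa using hw
      simp [this]
  | succ k ih => simpa [List.replicate_succ, List.dropWhile_cons] using ih

lemma head?_dropWhile_ne (i : ℕ) (w : List ℕ) : (w.dropWhile (· == i)).head? ≠ some i := by
  induction w with
  | nil => simp
  | cons u w ih =>
    by_cases h : u = i
    · subst h
      simpa [List.dropWhile_cons] using ih
    · simp [h]

lemma length_le_colorWt {i : ℕ} {w : List ℕ} (hw : w.head? ≠ some i) :
    w.length ≤ colorWt i w := by
  cases w with
  | nil => simp
  | cons u w =>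
    have h : u ≠ i := by simpa using hw
    have h1 : 1 ≤ u - i + (i - u) := by omega
    rw [colorWt, List.length_cons]
    nlinarith

/-- The coloured partition, listed increasingly and starting with the part `p` of colour `i`, whose
further colours are prescribed. -/
def buildParts : ℤ → ℕ → List ℕ → List (ℤ × ℕ)
  | p, i, [] => [(p, i)]
  | p, i, u :: w => (p, i) :: buildParts (p + |(u : ℤ) - i|) u w

lemma map_snd_buildParts (p : ℤ) (i : ℕ) (w : List ℕ) :
    (buildParts p i w).map Prod.snd = i :: w := by
  induction w generalizing p i with
  | nil => rfl
  | cons u w ih => simp [buildParts, ih]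

lemma head?_buildParts (p : ℤ) (i : ℕ) (w : List ℕ) :
    (buildParts p i w).head? = some (p, i) := by
  cases w <;> rfl

lemma sum_map_fst_buildParts (p : ℤ) (i : ℕ) (w : List ℕ) :
    ((buildParts p i w).map Prod.fst).sum = p * (w.length + 1) + colorWt i w := by
  induction w generalizing p i with
  | nil => simp [buildParts, colorWt]
  | cons u w ih =>
    have h : ((u - i + (i - u) : ℕ) : ℤ) = |(u : ℤ) - i| := by
      rw [Int.abs_eq_natAbs]
      omega
    simp only [buildParts, List.map_cons, List.sum_cons, ih, colorWt, List.length_cons]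
    rw [← h]
    push_cast
    ring

lemma isChain_and_head?_iff (p : ℤ) (i : ℕ) (L : List (ℤ × ℕ)) :
    L.IsChain (fun y x => x.1 - y.1 = |(x.2 : ℤ) - (y.2 : ℤ)|) ∧ L.head? = some (p, i) ↔
      ∃ w, L = buildParts p i w := by
  induction L generalizing p i with
  | nil =>
    simp only [List.head?_nil, reduceCtorEq, and_false, false_iff]
    rintro ⟨w, hw⟩
    have := head?_buildParts p i w
    simp [← hw] at this
  | cons x L ih =>
    cases L with
    | nil =>
      simp only [List.IsChain.singleton, List.head?_cons, Option.some.injEq, true_and]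
      constructor
      · rintro rfl
        exact ⟨[], rfl⟩
      · rintro ⟨w, hw⟩
        have := head?_buildParts p i w
        simpa [← hw] using this
    | cons y L =>
      rw [List.isChain_cons_cons]
      constructor
      · rintro ⟨⟨h1, h2⟩, h3⟩
        obtain rfl : x = (p, i) := by simpa using h3
        obtain ⟨q, u⟩ := y
        obtain ⟨w, hw⟩ := (ih q u).1 ⟨h2, rfl⟩
        obtain rfl : q = p + |(u : ℤ) - i| := by
          simp only at h1
          linarith
        exact ⟨u :: w, by rw [hw, buildParts]⟩
      · rintro ⟨w, hw⟩
        cases w with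
        | nil => simp [buildParts] at hw
        | cons u w =>
          rw [buildParts, List.cons.injEq] at hw
          obtain ⟨rfl, hw⟩ := hw
          have h := (ih _ _).2 ⟨w, hw⟩
          have hy : y = (p + |(u : ℤ) - i|, u) := by simpa using h.2
          refine ⟨⟨?_, h.1⟩, rfl⟩
          rw [hy]
          simp

lemma mem_CeqSet_iff {n i m : ℕ} (hi : i ≤ n) {L : List (ℤ × ℕ)} :
    L ∈ CeqSet n i m ↔ ∃ w : List ℕ, (∀ u ∈ w, u ≤ n) ∧ w.head? ≠ some i ∧ colorWt i w = m ∧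
      L = (buildParts 0 i w).reverse := by
  have key : ∀ w : List ℕ, (∀ q ∈ (buildParts 0 i w)[1]?, q.2 ≠ i) ↔ w.head? ≠ some i := by
    intro w
    cases w with
    | nil => simp [buildParts]
    | cons u w =>
      have := head?_buildParts (0 + |(u : ℤ) - i|) u w
      rw [List.head?_eq_getElem?] at this
      simp only [buildParts, List.getElem?_cons_succ, this]
      simp
  have hmem : ∀ w : List ℕ, (∀ q ∈ (buildParts 0 i w), q.2 ≤ n) ↔ ∀ u ∈ w, u ≤ n := by
    intro w
    have : (∀ q ∈ (buildParts 0 i w), q.2 ≤ n) ↔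
        ∀ u ∈ (buildParts 0 i w).map Prod.snd, u ≤ n := by
      rw [List.forall_mem_map]
    rw [this, map_snd_buildParts]
    simp [hi]
  have hsum : ∀ w : List ℕ, ((buildParts 0 i w).map Prod.fst).sum = (m : ℤ) ↔
      colorWt i w = m := by
    intro w
    rw [sum_map_fst_buildParts]
    simp
  constructor
  · rintro ⟨h1, h2, h3, h4, h5⟩
    have h2' : L.reverse.IsChain (fun y x => x.1 - y.1 = |(x.2 : ℤ) - (y.2 : ℤ)|) :=
      List.isChain_reverse.2 h2
    obtain ⟨w, hw⟩ := (isChain_and_head?_iff 0 i L.reverse).1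
      ⟨h2', by rw [List.head?_reverse, h3]⟩
    refine ⟨w, (hmem w).1 fun q hq => h1 q ?_, (key w).1 ?_, (hsum w).1 ?_, ?_⟩
    · rwa [← hw, List.mem_reverse] at hq
    · rwa [← hw]
    · rw [← hw, List.map_reverse, List.sum_reverse, h5]
    · rw [← hw, List.reverse_reverse]
  · rintro ⟨w, h1, h2, h3, rfl⟩
    have h := (isChain_and_head?_iff 0 i _).2 ⟨w, rfl⟩
    refine ⟨fun q hq => (hmem w).2 h1 q (List.mem_reverse.1 hq),
      List.isChain_reverse.2 h.1, by rw [List.getLast?_reverse, h.2], ?_, ?_⟩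
    · rw [List.reverse_reverse]
      exact (key w).2 h2
    · rw [List.map_reverse, List.sum_reverse]
      exact (hsum w).2 h3

lemma Ceq_eq_card {n i m M : ℕ} (hi : i ≤ n) (hM : m ≤ M) :
    Ceq n i m = ((colorLists n M).filter fun w => colorWt i w = m).card := by
  have himage : CeqSet n i m = (fun w : List ℕ => (buildParts 0 i (w.dropWhile (· == i))).reverse) ''
      (((colorLists n M).filter fun w => colorWt i w = m : Finset (List ℕ)) : Set (List ℕ)) := by
    ext L
    rw [mem_CeqSet_iff hi]
    simp only [Set.mem_image, mem_coe, mem_filter, mem_colorLists]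
    constructor
    · rintro ⟨w, h1, h2, h3, rfl⟩
      have hlen := length_le_colorWt h2
      have hd := dropWhile_replicate_append i (M - w.length) h2
      refine ⟨List.replicate (M - w.length) i ++ w, ⟨⟨?_, fun u hu => ?_⟩, ?_⟩, by rw [hd]⟩
      · rw [List.length_append, List.length_replicate]
        omega
      · rw [List.mem_append] at hu
        rcases hu with hu | hu
        · rw [List.eq_of_mem_replicate hu]
          exact hi
        · exact h1 u hu
      · rw [← colorWt_dropWhile, hd, h3]
    · rintro ⟨w, ⟨⟨-, h2⟩, h3⟩, rfl⟩
      exact ⟨_, fun u hu => h2 u ((List.dropWhile_suffix _).subset hu), head?_dropWhile_ne i w,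
        (colorWt_dropWhile i w).trans h3, rfl⟩
  rw [Ceq, himage, Set.InjOn.ncard_image, Set.ncard_coe_finset]
  intro w hw w' hw' h
  simp only [mem_coe, mem_filter, mem_colorLists] at hw hw'
  have h1 := congrArg (List.map Prod.snd) (List.reverse_injective h)
  rw [map_snd_buildParts, map_snd_buildParts, List.cons.injEq] at h1
  rw [← replicate_append_dropWhile i w, ← replicate_append_dropWhile i w', h1.2, hw.1.1, hw'.1.1]

/-- The sequences of level data `(a, b, c)` over `d` levels: `c` is the frequency of the part `2 k`,
while `a` and `b` are the frequencies of `2 k + 1`, plain and underlined. The frequencies of the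
odd part below the first level are `l` and `r`. -/
def levelLists (n : ℕ) : ℕ → ℕ → ℕ → Finset (List (ℕ × ℕ × ℕ))
  | 0, l, r => if l = 0 ∧ r = 0 then {[]} else ∅
  | d + 1, l, r => ((range (n + 1) ×ˢ range (n + 1) ×ˢ range (n + 1)).filter fun p =>
      max l p.2.1 + p.2.2 + max p.1 r ≤ n).biUnion fun p =>
        (levelLists n d p.1 p.2.1).image (List.cons p)

/-- The weight of level data starting at level `k`. -/
def levelWt : ℕ → List (ℕ × ℕ × ℕ) → ℕ
  | _, [] => 0
  | k, p :: t => 2 * k * p.2.2 + (2 * k + 1) * (p.1 + p.2.1) + levelWt (k + 1) t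

lemma mem_levelLists_succ {n d l r : ℕ} {t : List (ℕ × ℕ × ℕ)} :
    t ∈ levelLists n (d + 1) l r ↔ ∃ a b c t', max l b + c + max a r ≤ n ∧
      t' ∈ levelLists n d a b ∧ t = (a, b, c) :: t' := by
  simp only [levelLists, mem_biUnion, mem_filter, mem_product, mem_range, mem_image, Prod.exists]
  constructor
  · rintro ⟨a, b, c, ⟨-, h⟩, t', ht, rfl⟩
    exact ⟨a, b, c, t', h, ht, rfl⟩
  · rintro ⟨a, b, c, t', h, ht, rfl⟩
    exact ⟨a, b, c, ⟨by omega, h⟩, t', ht, rfl⟩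

lemma transferSum_eq_sum (n d k l r : ℕ) :
    transferSum n d k l r = ∑ t ∈ levelLists n d l r, X ^ levelWt k t := by
  induction d generalizing k l r with
  | zero =>
    simp only [transferSum, levelLists]
    split_ifs <;> simp [levelWt]
  | succ d ih =>
    rw [levelLists, sum_biUnion, sum_filter, sum_product, transferSum]
    · refine sum_congr rfl fun a _ => ?_
      rw [sum_product]
      refine sum_congr rfl fun b _ => sum_congr rfl fun c _ => ?_
      refine if_congr Iff.rfl ?_ rfl
      rw [sum_image fun _ _ _ _ h => (List.cons.inj h).2, ih, mul_sum]
      exact sum_congr rfl fun t _ => by simp only [levelWt, pow_add, mul_assoc]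
    · intro p _ q _ hpq
      rw [Function.onFun, disjoint_left]
      simp only [mem_image, not_exists, not_and]
      rintro _ ⟨t, _, rfl⟩ t' _ h
      exact hpq (List.cons.inj h).1.symm

/-- The frequency data of Meurman–Primc partitions with parts at most `2 K`. -/
def mpData (n i K : ℕ) : Finset ((ℕ × ℕ) × List (ℕ × ℕ × ℕ)) :=
  (range (n - i + 1) ×ˢ range (i + 1)).biUnion fun p => (levelLists n K p.1 p.2).image (Prod.mk p)

lemma mem_mpData {n i K : ℕ} {x : (ℕ × ℕ) × List (ℕ × ℕ × ℕ)} :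
    x ∈ mpData n i K ↔ x.1.1 ≤ n - i ∧ x.1.2 ≤ i ∧ x.2 ∈ levelLists n K x.1.1 x.1.2 := by
  simp only [mpData, mem_biUnion, mem_product, mem_range, mem_image]
  constructor
  · rintro ⟨p, ⟨h1, h2⟩, t, ht, rfl⟩
    exact ⟨Nat.lt_succ_iff.1 h1, Nat.lt_succ_iff.1 h2, ht⟩
  · rintro ⟨h1, h2, ht⟩
    exact ⟨x.1, ⟨by omega, by omega⟩, x.2, ht, rfl⟩

lemma mpSum_eq_sum (n i K : ℕ) :
    mpSum n i K = ∑ x ∈ mpData n i K, X ^ (x.1.1 + x.1.2 + levelWt 1 x.2) := by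
  rw [mpData, sum_biUnion, sum_product, mpSum]
  · refine sum_congr rfl fun a _ => sum_congr rfl fun b _ => ?_
    rw [sum_image fun _ _ _ _ h => (Prod.mk.inj h).2, transferSum_eq_sum, mul_sum]
    exact sum_congr rfl fun t _ => by rw [pow_add _ (a + b)]
  · intro p _ q _ hpq
    rw [Function.onFun, disjoint_left]
    simp only [mem_image, not_exists, not_and]
    rintro _ ⟨t, _, rfl⟩ t' _ h
    exact hpq (Prod.mk.inj h).1.symm

/-- The frequencies of the plain parts recorded by level data. -/
def plainFreqs : List (ℕ × ℕ × ℕ) → List ℕ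
  | [] => []
  | p :: t => p.2.2 :: p.1 :: plainFreqs t

/-- The frequencies of the underlined parts recorded by level data. -/
def underlinedFreqs : List (ℕ × ℕ × ℕ) → List ℕ
  | [] => []
  | p :: t => 0 :: p.2.1 :: underlinedFreqs t

/-- The local conditions on Meurman–Primc partitions, in terms of the frequencies `φ j` and `γ j`
of the part `j + 1`, plain and underlined. -/
def FreqCond (n : ℕ) (φ γ : ℕ → ℕ) : Prop :=
  ∀ q, γ (2 * q + 1) = 0 ∧
    max (φ (2 * q)) (γ (2 * q + 2)) + φ (2 * q + 1) + max (φ (2 * q + 2)) (γ (2 * q)) ≤ n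

lemma freqCond_iff_succ {n : ℕ} {φ γ : ℕ → ℕ} :
    FreqCond n φ γ ↔ (γ 1 = 0 ∧ max (φ 0) (γ 2) + φ 1 + max (φ 2) (γ 0) ≤ n) ∧
      FreqCond n (fun j => φ (j + 2)) (fun j => γ (j + 2)) := by
  constructor
  · intro h
    exact ⟨h 0, fun q => h (q + 1)⟩
  · rintro ⟨h0, h⟩ (_ | q)
    · exact h0
    · exact h q

lemma freqCond_of_mem_levelLists {n d l r : ℕ} {t : List (ℕ × ℕ × ℕ)}
    (ht : t ∈ levelLists n d l r) :
    FreqCond n (fun j => (l :: plainFreqs t).getD j 0)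
      (fun j => (r :: underlinedFreqs t).getD j 0) := by
  induction d generalizing l r t with
  | zero =>
    simp only [levelLists] at ht
    split_ifs at ht with h
    · obtain ⟨rfl, rfl⟩ := h
      rw [mem_singleton] at ht
      subst ht
      intro q
      cases q <;> simp [plainFreqs, underlinedFreqs]
    · simp at ht
  | succ d ih =>
    obtain ⟨a, b, c, t', h, ht', rfl⟩ := mem_levelLists_succ.1 ht
    rw [freqCond_iff_succ]
    exact ⟨⟨rfl, h⟩, ih ht'⟩

lemma exists_mem_levelLists {n d : ℕ} {φ γ : ℕ → ℕ} (h : FreqCond n φ γ)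
    (hzero : ∀ j, 2 * d ≤ j → φ j = 0 ∧ γ j = 0) :
    ∃ t ∈ levelLists n d (φ 0) (γ 0), (∀ j, φ j = (φ 0 :: plainFreqs t).getD j 0) ∧
      ∀ j, γ j = (γ 0 :: underlinedFreqs t).getD j 0 := by
  induction d generalizing φ γ with
  | zero =>
    refine ⟨[], by simp [levelLists, hzero], fun j => ?_, fun j => ?_⟩ <;>
      cases j <;> simp [plainFreqs, underlinedFreqs, hzero]
  | succ d ih =>
    rw [freqCond_iff_succ] at h
    obtain ⟨t, ht, h1, h2⟩ := ih h.2 fun j hj => hzero (j + 2) (by omega)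
    refine ⟨(φ 2, γ 2, φ 1) :: t, mem_levelLists_succ.2 ⟨_, _, _, t, h.1.2, ht, rfl⟩, ?_, ?_⟩
    · rintro (_ | _ | j)
      · rfl
      · rfl
      · exact h1 j
    · rintro (_ | _ | j)
      · rfl
      · exact h.1.1
      · exact h2 j

lemma length_of_mem_levelLists {n d l r : ℕ} {t : List (ℕ × ℕ × ℕ)}
    (ht : t ∈ levelLists n d l r) : t.length = d := by
  induction d generalizing l r t with
  | zero =>
    simp only [levelLists] at ht
    split_ifs at ht
    · rw [mem_singleton] at ht
      simp [ht]
    · simp at ht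
  | succ d ih =>
    obtain ⟨a, b, c, t', -, ht', rfl⟩ := mem_levelLists_succ.1 ht
    rw [List.length_cons, ih ht']

lemma length_plainFreqs (t : List (ℕ × ℕ × ℕ)) : (plainFreqs t).length = 2 * t.length := by
  induction t with
  | nil => rfl
  | cons p t ih => simp only [plainFreqs, List.length_cons, ih]; ring

lemma length_underlinedFreqs (t : List (ℕ × ℕ × ℕ)) :
    (underlinedFreqs t).length = 2 * t.length := by
  induction t with
  | nil => rfl
  | cons p t ih => simp only [underlinedFreqs, List.length_cons, ih]; ring

lemma eq_of_freqs_eq {t t' : List (ℕ × ℕ × ℕ)} (h1 : plainFreqs t = plainFreqs t')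
    (h2 : underlinedFreqs t = underlinedFreqs t') : t = t' := by
  induction t generalizing t' with
  | nil =>
    cases t' with
    | nil => rfl
    | cons q t' => simp [plainFreqs] at h1
  | cons p t ih =>
    cases t' with
    | nil => simp [plainFreqs] at h1
    | cons q t' =>
      simp only [plainFreqs, underlinedFreqs, List.cons.injEq, true_and] at h1 h2
      rw [ih h1.2.2 h2.2]
      congr 1
      exact Prod.ext h1.2.1 (Prod.ext h2.1 h1.1)

/-- The sum of the entries of a list weighted by their positions, counted from `s`. -/
def positionWt : ℕ → List ℕ → ℕ
  | _, [] => 0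
  | s, x :: L => s * x + positionWt (s + 1) L

lemma sum_toFinsupp (L : List ℕ) : (L.toFinsupp.sum fun k v => k * v) = positionWt 0 L := by
  have h : ∀ s, ∑ j ∈ range L.length, (s + j) * L.getD j 0 = positionWt s L := by
    induction L with
    | nil => intro s; rfl
    | cons x L ih =>
      intro s
      rw [List.length_cons, sum_range_succ', positionWt, ← ih (s + 1), add_comm]
      congr 1
      exact sum_congr rfl fun j _ => by rw [List.getD_cons_succ]; ring
  rw [← h 0, Finsupp.sum_of_support_subset _ L.toFinsupp_support_subset _ (by simp)]
  simp [List.toFinsupp_apply]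

lemma positionWt_freqs (k : ℕ) (t : List (ℕ × ℕ × ℕ)) :
    positionWt (2 * k) (plainFreqs t) + positionWt (2 * k) (underlinedFreqs t) = levelWt k t := by
  induction t generalizing k with
  | nil => rfl
  | cons p t ih =>
    simp only [plainFreqs, underlinedFreqs, positionWt, levelWt, ← ih]
    rw [show 2 * k + 1 + 1 = 2 * (k + 1) by ring]
    ring

lemma toFinsupp_inj {L L' : List ℕ} (hlen : L.length = L'.length)
    (h : L.toFinsupp = L'.toFinsupp) : L = L' := by
  refine List.ext_getElem hlen fun j h1 h2 => ?_
  have := DFunLike.congr_fun h j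
  simpa [List.toFinsupp_apply, List.getD_eq_getElem, h1, h2] using this

/-- The pair of frequency functions recorded by frequency data. -/
noncomputable def toFreqs (x : (ℕ × ℕ) × List (ℕ × ℕ × ℕ)) : (ℕ →₀ ℕ) × (ℕ →₀ ℕ) :=
  ((0 :: x.1.1 :: plainFreqs x.2).toFinsupp, (0 :: x.1.2 :: underlinedFreqs x.2).toFinsupp)

lemma sum_toFreqs (x : (ℕ × ℕ) × List (ℕ × ℕ × ℕ)) :
    ((toFreqs x).1.sum fun k v => k * v) + ((toFreqs x).2.sum fun k v => k * v) =
      x.1.1 + x.1.2 + levelWt 1 x.2 := by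
  rw [toFreqs, sum_toFinsupp, sum_toFinsupp, ← positionWt_freqs]
  simp only [positionWt]
  ring

lemma mem_MPSet_iff {n i m : ℕ} {fg : (ℕ →₀ ℕ) × (ℕ →₀ ℕ)} :
    fg ∈ MPSet n i m ↔ fg.1 0 = 0 ∧ fg.2 0 = 0 ∧
      FreqCond n (fun j => fg.1 (j + 1)) (fun j => fg.2 (j + 1)) ∧
      fg.2 1 ≤ i ∧ fg.1 1 ≤ n - i ∧
      (fg.1.sum fun k v => k * v) + (fg.2.sum fun k v => k * v) = m := by
  have e : ∀ q, 2 * (q + 1) - 1 = 2 * q + 1 := fun q => by omega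
  have hz : (∀ k ≥ 1, fg.2 (2 * k) = 0) ↔ ∀ q, fg.2 (2 * q + 1 + 1) = 0 :=
    ⟨fun h q => h (q + 1) (by omega), fun h k hk => by
      obtain ⟨q, rfl⟩ := Nat.exists_eq_add_of_le' hk
      exact h q⟩
  constructor
  · rintro ⟨h1, h2, h3, h4, h5, h6, h7, h8, h9, h10⟩
    refine ⟨h1, h2, fun q => ⟨hz.1 h3 q, ?_⟩, h8, h9, h10⟩
    have a4 := h4 (q + 1) (by omega)
    have a5 := h5 (q + 1) (by omega)
    have a6 := h6 (q + 1) (by omega)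
    have a7 := h7 (q + 1) (by omega)
    rw [e] at a4 a5 a7
    rw [show 2 * (q + 1) = 2 * q + 1 + 1 by ring] at a4 a5 a6 a7
    change max (fg.1 (2 * q + 1)) (fg.2 (2 * q + 1 + 1 + 1)) + fg.1 (2 * q + 1 + 1) +
      max (fg.1 (2 * q + 1 + 1 + 1)) (fg.2 (2 * q + 1)) ≤ n
    omega
  · rintro ⟨h1, h2, h3, h8, h9, h10⟩
    have key : ∀ k ≥ 1, fg.1 (2 * k + 1) + fg.1 (2 * k) + fg.1 (2 * k - 1) ≤ n ∧
        fg.1 (2 * k) + fg.2 (2 * k - 1) + fg.1 (2 * k - 1) ≤ n ∧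
        fg.2 (2 * k + 1) + fg.1 (2 * k + 1) + fg.1 (2 * k) ≤ n ∧
        fg.2 (2 * k + 1) + fg.1 (2 * k) + fg.2 (2 * k - 1) ≤ n := by
      intro k hk
      obtain ⟨q, rfl⟩ := Nat.exists_eq_add_of_le' hk
      have h : max (fg.1 (2 * q + 1)) (fg.2 (2 * q + 1 + 1 + 1)) + fg.1 (2 * q + 1 + 1) +
        max (fg.1 (2 * q + 1 + 1 + 1)) (fg.2 (2 * q + 1)) ≤ n := (h3 q).2
      rw [e, show 2 * (q + 1) = 2 * q + 1 + 1 by ring]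
      omega
    exact ⟨h1, h2, hz.2 fun q => (h3 q).1, fun k hk => (key k hk).1, fun k hk => (key k hk).2.1,
      fun k hk => (key k hk).2.2.1, fun k hk => (key k hk).2.2.2, h8, h9, h10⟩

lemma apply_eq_zero_of_sum_lt {f : ℕ →₀ ℕ} {j : ℕ} (h : (f.sum fun k v => k * v) < j) :
    f j = 0 := by
  by_contra hne
  have h1 : j * f j ≤ f.sum fun k v => k * v :=
    Finset.single_le_sum (f := fun k => k * f k) (fun _ _ => Nat.zero_le _)
      (Finsupp.mem_support_iff.2 hne)
  have h2 : j * 1 ≤ j * f j := Nat.mul_le_mul_left _ (Nat.one_le_iff_ne_zero.2 hne)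
  omega

lemma MP_eq_card {n i m K : ℕ} (hK : m ≤ K) :
    MP n i m =
      ((mpData n i K).filter fun x => x.1.1 + x.1.2 + levelWt 1 x.2 = m).card := by
  have himage : MPSet n i m = toFreqs '' (((mpData n i K).filter fun x =>
      x.1.1 + x.1.2 + levelWt 1 x.2 = m : Finset _) : Set ((ℕ × ℕ) × List (ℕ × ℕ × ℕ))) := by
    ext fg
    rw [mem_MPSet_iff]
    simp only [Set.mem_image, mem_coe, mem_filter, mem_mpData]
    constructor
    · rintro ⟨h1, h2, h3, h4, h5, h6⟩
      obtain ⟨t, ht, hφ, hγ⟩ := exists_mem_levelLists (d := K) h3 fun j hj =>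
        ⟨apply_eq_zero_of_sum_lt (by omega), apply_eq_zero_of_sum_lt (by omega)⟩
      have hfg : toFreqs ((fg.1 1, fg.2 1), t) = fg := by
        refine Prod.ext (Finsupp.ext ?_) (Finsupp.ext ?_)
        · rintro (_ | j)
          · exact h1.symm
          · exact (hφ j).symm
        · rintro (_ | j)
          · exact h2.symm
          · exact (hγ j).symm
      refine ⟨_, ⟨⟨h5, h4, ht⟩, ?_⟩, hfg⟩
      rw [← sum_toFreqs, hfg, h6]
    · rintro ⟨x, ⟨⟨h5, h4, ht⟩, hm⟩, rfl⟩
      exact ⟨rfl, rfl, freqCond_of_mem_levelLists ht, h4, h5, (sum_toFreqs x).trans hm⟩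
  rw [MP, himage, Set.InjOn.ncard_image, Set.ncard_coe_finset]
  rintro ⟨⟨a, b⟩, t⟩ hx ⟨⟨a', b'⟩, t'⟩ hy h
  simp only [mem_coe, mem_filter, mem_mpData] at hx hy
  have hlen : t.length = t'.length := by
    rw [length_of_mem_levelLists hx.1.2.2, length_of_mem_levelLists hy.1.2.2]
  have h1 := toFinsupp_inj (by simp [length_plainFreqs, hlen]) (congrArg Prod.fst h)
  have h2 := toFinsupp_inj (by simp [length_underlinedFreqs, hlen]) (congrArg Prod.snd h)
  simp only [List.cons.injEq, true_and] at h1 h2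
  rw [h1.1, h2.1, eq_of_freqs_eq h1.2 h2.2]

lemma Ceq_eq_MP {n i : ℕ} (m : ℕ) (hi : i ≤ n) : Ceq n i m = MP n i m := by
  have h := PowerSeries.X_pow_dvd_iff.1 (X_pow_dvd_colorSum_sub_mpSum n i m hi) m m.lt_succ_self
  rw [map_sub, colorSum_eq_sum, mpSum_eq_sum, coeff_sum_X_pow, coeff_sum_X_pow, sub_eq_zero,
    Nat.cast_inj] at h
  rw [Ceq_eq_card hi (M := 2 * (m + 1)) (by omega), MP_eq_card m.le_succ, h]

end MeurmanPrimc

/-- For all `0 ≤ i ≤ n` and `m ≥ 0`, `C_{i,n}(m) = M_{i,n}(m)`. -/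
theorem ceqEqMP (n i m : ℕ) (hi : i ≤ n) :
    Ceq n i m = MP n i m := by
  exact MeurmanPrimc.Ceq_eq_MP m hi
end

section
/- With H(b_i ⊗ b_j) = max(i, 2−j) − 1, the generating function of grounded partitions with ground c_1 and relation ≫ satisfies: ∑_{π ∈ 𝒫^≫_{c_1}} C(π) q^{|π|} = c_1 (−c_0 q; q)_∞ (−c_2; q)_∞ / ((c_1 q; q)_∞ (c_0 c_2 q; q²)_∞), valid for complex q, c_0, c_1, c_2 with |q| < 1 and |c_0|, |c_1|, |c_2| ≤ 1 (equivalently, as an identity of formal power series in c_0, c_1, c_2, q). -/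
open scoped BigOperators

/-- The infinite q-Pochhammer symbol `(a; q)_∞ = ∏_{k≥0} (1 - a qᵏ)`. -/
noncomputable def qPoch (a q : ℂ) : ℂ := ∏' k : ℕ, (1 - a * q ^ k)

/-- The energy function `H(b_i ⊗ b_j) = max(i, 2−j) − 1` for the level-2 perfect crystal
of `A_1^{(1)}`, with `i, j ∈ {0,1,2}`, valued in `ℤ`. -/
def H2 (i j : ℕ) : ℤ := max (i : ℤ) (2 - (j : ℤ)) - 1

/-- The relation `≫` between consecutive parts: writing `x = π_k` and `y = π_{k+1}` as pairs
(part, colour), it requires `p_k − p_{k+1} ≥ H(b_{a_{k+1}} ⊗ b_{a_k})`. -/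
def StepGG (x y : ℤ × ℕ) : Prop := x.1 - y.1 ≥ H2 y.2 x.2

/-- Grounded partitions with colours `{c_0, c_1, c_2}`, ground `c_1` and relation `≫`:
lists of (part, colour) pairs with colours in `{0,1,2}`, consecutive parts satisfying `≫`,
last part `0` with colour `c_1`, and penultimate part (if any) not equal to `0_{c_1}`. -/
def Grounded1 (L : List (ℤ × ℕ)) : Prop :=
  (∀ p ∈ L, p.2 ≤ 2) ∧ List.Chain' StepGG L ∧
    L.getLast? = some (0, 1) ∧ (∀ p ∈ L.reverse[1]?, p ≠ ((0 : ℤ), 1))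

/-- The generating function `∑_π C(π) q^{|π|}` over all lists satisfying a predicate `P`, where
`C(π) = c_0^A c_1^B c_2^D` records the numbers of parts of each colour, and `|π|` is the sum
of the parts. -/
noncomputable def genFun (P : List (ℤ × ℕ) → Prop) (q c0 c1 c2 : ℂ) : ℂ :=
  ∑' L : {L : List (ℤ × ℕ) // P L},
    c0 ^ (L.1.countP fun p => p.2 == 0) * c1 ^ (L.1.countP fun p => p.2 == 1) *
      c2 ^ (L.1.countP fun p => p.2 == 2) * q ^ ((L.1.map Prod.fst).sum)

/-- The coloured sequences, listed from the smallest part upwards, that may be stacked on top of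
the part `s`. -/
def StackedOn (s : ℤ × ℕ) : Set (List (ℤ × ℕ)) :=
  {R | (∀ p ∈ R, p.2 ≤ 2) ∧ (s :: R).IsChain fun y x => StepGG x y}

theorem nil_mem_stackedOn (s : ℤ × ℕ) : [] ∈ StackedOn s := by
  simp [StackedOn]

theorem cons_mem_stackedOn {s t : ℤ × ℕ} {R : List (ℤ × ℕ)} :
    t :: R ∈ StackedOn s ↔ t.2 ≤ 2 ∧ StepGG t s ∧ R ∈ StackedOn t := by
  simp only [StackedOn, Set.mem_ofPred_eq, List.mem_cons, forall_eq_or_imp, List.isChain_cons_cons]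
  tauto

theorem stackedOn_two (n : ℤ) :
    StackedOn (n, 2) = StackedOn (n + 1, 2) ∪ (List.cons (n + 1, 2) '' StackedOn (n + 1, 2) ∪
      (List.cons (n + 1, 1) '' StackedOn (n + 1, 1) ∪
        List.cons (n + 1, 0) '' StackedOn (n + 1, 0))) := by
  ext R
  rcases R with _ | ⟨⟨m, j⟩, R⟩
  · simp [nil_mem_stackedOn]
  · simp only [Set.mem_union, Set.mem_image, cons_mem_stackedOn, List.cons.injEq, Prod.mk.injEq,
      StepGG, H2]
    constructor
    · rintro ⟨hj, h, hR⟩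
      by_cases hm : m = n + 1
      · subst hm
        interval_cases j <;> simp_all
      · exact Or.inl ⟨hj, by grind, hR⟩
    · rintro (⟨hj, h, hR⟩ | ⟨R', hR, ⟨rfl, rfl⟩, rfl⟩ | ⟨R', hR, ⟨rfl, rfl⟩, rfl⟩ |
        ⟨R', hR, ⟨rfl, rfl⟩, rfl⟩)
      · exact ⟨hj, by grind, hR⟩
      all_goals exact ⟨by norm_num, by grind, hR⟩

theorem stackedOn_one (n : ℤ) :
    StackedOn (n, 1) = StackedOn (n, 2) ∪ (List.cons (n, 1) '' StackedOn (n, 1) ∪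
      List.cons (n, 2) '' StackedOn (n, 2)) := by
  ext R
  rcases R with _ | ⟨⟨m, j⟩, R⟩
  · simp [nil_mem_stackedOn]
  · simp only [Set.mem_union, Set.mem_image, cons_mem_stackedOn, List.cons.injEq, Prod.mk.injEq,
      StepGG, H2]
    constructor
    · rintro ⟨hj, h, hR⟩
      by_cases hm : m = n
      · subst hm
        interval_cases j <;> simp_all
      · exact Or.inl ⟨hj, by grind, hR⟩
    · rintro (⟨hj, h, hR⟩ | ⟨R', hR, ⟨rfl, rfl⟩, rfl⟩ | ⟨R', hR, ⟨rfl, rfl⟩, rfl⟩)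
      · exact ⟨hj, by grind, hR⟩
      all_goals exact ⟨by norm_num, by grind, hR⟩

theorem stackedOn_zero (n : ℤ) :
    StackedOn (n + 1, 0) =
      StackedOn (n + 1, 1) ∪ List.cons (n, 2) '' StackedOn (n, 2) := by
  ext R
  rcases R with _ | ⟨⟨m, j⟩, R⟩
  · simp [nil_mem_stackedOn]
  · simp only [Set.mem_union, Set.mem_image, cons_mem_stackedOn, List.cons.injEq, Prod.mk.injEq,
      StepGG, H2]
    constructor
    · rintro ⟨hj, h, hR⟩
      by_cases hm : m = n ∧ j = 2
      · obtain ⟨rfl, rfl⟩ := hm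
        simp_all
      · exact Or.inl ⟨hj, by grind, hR⟩
    · rintro (⟨hj, h, hR⟩ | ⟨R', hR, ⟨rfl, rfl⟩, rfl⟩)
      · exact ⟨hj, by grind, hR⟩
      · exact ⟨by norm_num, by grind, hR⟩

theorem disjoint_stackedOn_image_cons {s t : ℤ × ℕ} (h : ¬ StepGG t s)
    (B : Set (List (ℤ × ℕ))) : Disjoint (StackedOn s) (List.cons t '' B) := by
  rw [Set.disjoint_right]
  rintro _ ⟨R, -, rfl⟩ hR
  exact h (cons_mem_stackedOn.1 hR).2.1

theorem disjoint_image_cons {s t : ℤ × ℕ} (h : s ≠ t) (A B : Set (List (ℤ × ℕ))) :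
    Disjoint (List.cons s '' A) (List.cons t '' B) := by
  rw [Set.disjoint_left]
  rintro _ ⟨R, -, rfl⟩ ⟨R', -, hR⟩
  exact h (List.cons.inj hR).1.symm

theorem stackedOn_two_anti {m n : ℤ} (h : m ≤ n) : StackedOn (n, 2) ⊆ StackedOn (m, 2) := by
  rintro (_ | ⟨t, R⟩) hR
  · exact nil_mem_stackedOn _
  · rw [cons_mem_stackedOn] at hR ⊢
    refine ⟨hR.1, ?_, hR.2.2⟩
    have := hR.2.1
    simp only [StepGG] at this ⊢
    linarith

theorem nonneg_of_mem_stackedOn {s : ℤ × ℕ} {R : List (ℤ × ℕ)} (hs : 0 ≤ s.1)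
    (hs' : s.2 = 0 → 1 ≤ s.1) (hR : R ∈ StackedOn s) : ∀ p ∈ R, 0 ≤ p.1 := by
  induction R generalizing s with
  | nil => simp
  | cons t R ih =>
    obtain ⟨ht, hst, hR⟩ := cons_mem_stackedOn.1 hR
    simp only [StepGG, H2] at hst
    have h : 0 ≤ t.1 := by grind
    have h' : t.2 = 0 → 1 ≤ t.1 := by grind
    simpa using ⟨h, fun a b hab => ih h h' hR (a, b) hab⟩

section HasSum

variable {α : Type*} [Semiring α] [TopologicalSpace α] [IsTopologicalSemiring α]

theorem HasSum.indicator_union {ι : Type*} {A B : Set ι} {w : ι → α} {a b : α}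
    (ha : HasSum (A.indicator w) a) (hb : HasSum (B.indicator w) b) (h : Disjoint A B) :
    HasSum ((A ∪ B).indicator w) (a + b) := by
  rw [Set.indicator_union_of_disjoint h]
  exact ha.add hb

theorem HasSum.indicator_image_cons {γ : Type*} {t : γ} {B : Set (List γ)} {w w' : List γ → α}
    {x b : α} (hb : HasSum (B.indicator w') b) (h : ∀ R, w (t :: R) = x * w' R) :
    HasSum ((List.cons t '' B).indicator w) (x * b) := by
  rw [← (List.cons_injective (a := t)).hasSum_iff]
  · have hB : (List.cons t '' B).indicator w ∘ List.cons t = fun R => x * B.indicator w' R := by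
      funext R
      by_cases hR : R ∈ B <;> simp [hR, h, Set.indicator]
    rw [hB]
    exact hb.mul_left x
  · rintro R hR
    exact Set.indicator_of_notMem (fun h => hR (Set.image_subset_range _ _ h)) _

variable {x : ℤ × ℕ → α} {w w' : List (ℤ × ℕ) → α}

theorem hasSum_stackedOn_two (hw : ∀ t R, w (t :: R) = x t * w' R) (n : ℤ) {a b c d : α}
    (ha : HasSum ((StackedOn (n + 1, 2)).indicator w) a)
    (hb : HasSum ((StackedOn (n + 1, 2)).indicator w') b)
    (hc : HasSum ((StackedOn (n + 1, 1)).indicator w') c)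
    (hd : HasSum ((StackedOn (n + 1, 0)).indicator w') d) :
    HasSum ((StackedOn (n, 2)).indicator w)
      (a + (x (n + 1, 2) * b + (x (n + 1, 1) * c + x (n + 1, 0) * d))) := by
  rw [stackedOn_two]
  refine ha.indicator_union ((hb.indicator_image_cons (hw _)).indicator_union
    ((hc.indicator_image_cons (hw _)).indicator_union (hd.indicator_image_cons (hw _)) ?_) ?_) ?_
  · exact disjoint_image_cons (by simp) _ _
  · exact Disjoint.union_right (disjoint_image_cons (by simp) _ _)
      (disjoint_image_cons (by simp) _ _)
  · refine Disjoint.union_right ?_ (Disjoint.union_right ?_ ?_) <;>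
      exact disjoint_stackedOn_image_cons (by simp [StepGG, H2]) _

theorem hasSum_stackedOn_one (hw : ∀ t R, w (t :: R) = x t * w' R) (n : ℤ) {a b c : α}
    (ha : HasSum ((StackedOn (n, 2)).indicator w) a)
    (hc : HasSum ((StackedOn (n, 1)).indicator w') c)
    (hb : HasSum ((StackedOn (n, 2)).indicator w') b) :
    HasSum ((StackedOn (n, 1)).indicator w) (a + (x (n, 1) * c + x (n, 2) * b)) := by
  rw [stackedOn_one]
  refine ha.indicator_union ((hc.indicator_image_cons (hw _)).indicator_union
    (hb.indicator_image_cons (hw _)) ?_) ?_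
  · exact disjoint_image_cons (by simp) _ _
  · refine Disjoint.union_right ?_ ?_ <;>
      exact disjoint_stackedOn_image_cons (by simp [StepGG, H2]) _

theorem hasSum_stackedOn_zero (hw : ∀ t R, w (t :: R) = x t * w' R) (n : ℤ) {a b : α}
    (ha : HasSum ((StackedOn (n + 1, 1)).indicator w) a)
    (hb : HasSum ((StackedOn (n, 2)).indicator w') b) :
    HasSum ((StackedOn (n + 1, 0)).indicator w) (a + x (n, 2) * b) := by
  rw [stackedOn_zero]
  exact ha.indicator_union (hb.indicator_image_cons (hw _))
    (disjoint_stackedOn_image_cons (by simp [StepGG, H2]) _)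

end HasSum

/-- The weight `r ^ |R|` of a coloured sequence, negative parts counting as `0`. -/
noncomputable def sizeWeight (r : ℝ) (R : List (ℤ × ℕ)) : ℝ :=
  (R.map fun p => r ^ p.1.toNat).prod

open Classical in
/-- The weight `sizeWeight r` restricted to sequences with at most `N` parts, all of them at
most `M`. -/
noncomputable def truncWeight (r : ℝ) (M N : ℕ) (R : List (ℤ × ℕ)) : ℝ :=
  if R.length ≤ N ∧ ∀ p ∈ R, p.1 ≤ M then sizeWeight r R else 0

/-- A function such that `growthBound r n` bounds the sum of `r ^ |R|` over the sequences `R`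
stacked on `n` coloured `c_2`. -/
noncomputable def growthBound (r : ℝ) (n : ℕ) : ℝ := Real.exp (5 / (1 - r) ^ 3 * r ^ n)

section Bound

variable {r : ℝ}

theorem sizeWeight_nonneg (h0 : 0 ≤ r) (R : List (ℤ × ℕ)) : 0 ≤ sizeWeight r R := by
  refine List.prod_nonneg fun a ha => ?_
  obtain ⟨p, -, rfl⟩ := List.mem_map.1 ha
  positivity

theorem truncWeight_nonneg (h0 : 0 ≤ r) (M N : ℕ) (R : List (ℤ × ℕ)) :
    0 ≤ truncWeight r M N R := by
  unfold truncWeight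
  split_ifs
  exacts [sizeWeight_nonneg h0 R, le_rfl]

theorem truncWeight_nil (M N : ℕ) : truncWeight r M N [] = 1 := by
  simp [truncWeight, sizeWeight]

theorem truncWeight_cons (M N : ℕ) (t : ℤ × ℕ) (R : List (ℤ × ℕ)) :
    truncWeight r M (N + 1) (t :: R) =
      (if t.1 ≤ M then r ^ t.1.toNat else 0) * truncWeight r M N R := by
  have h : ((t :: R).length ≤ N + 1 ∧ ∀ p ∈ t :: R, p.1 ≤ M) ↔
      t.1 ≤ M ∧ R.length ≤ N ∧ ∀ p ∈ R, p.1 ≤ M := by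
    rw [List.forall_mem_cons, List.length_cons, Nat.add_le_add_iff_right]
    tauto
  unfold truncWeight
  rw [if_congr h rfl rfl, ite_and, ite_mul, zero_mul, mul_ite, mul_zero]
  simp [sizeWeight]

theorem hasSum_indicator_of_eq_zero {α : Type*} [Semiring α] [TopologicalSpace α] {s : ℤ × ℕ}
    {w : List (ℤ × ℕ) → α} (h1 : w [] = 1) (h : ∀ t R, t :: R ∈ StackedOn s → w (t :: R) = 0) :
    HasSum ((StackedOn s).indicator w) 1 := by
  convert hasSum_single (f := (StackedOn s).indicator w) [] ?_ using 1
  · rw [Set.indicator_of_mem (nil_mem_stackedOn s), h1]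
  · rintro (_ | ⟨t, R⟩) hR
    · exact absurd rfl hR
    · by_cases hs : t :: R ∈ StackedOn s
      · rw [Set.indicator_of_mem hs, h t R hs]
      · exact Set.indicator_of_notMem hs _

theorem one_le_growthBound (h0 : 0 ≤ r) (h1 : r < 1) (n : ℕ) : 1 ≤ growthBound r n := by
  have : 0 < 1 - r := by linarith
  exact Real.one_le_exp (by positivity)

theorem growthBound_step (h0 : 0 ≤ r) (h1 : r < 1) (n : ℕ) :
    growthBound r (n + 1) * ((1 + r ^ (n + 1)) * (1 + r ^ (n + 1))) ≤
      growthBound r n * ((1 - r ^ (n + 1)) * (1 - r ^ (n + 1) * r ^ n)) := by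
  have hd : 0 < 1 - r := by linarith
  have hy0 : 0 ≤ r ^ n := by positivity
  have hy1 : r ^ n ≤ 1 := pow_le_one₀ h0 h1.le
  have hx : r ^ (n + 1) = r * r ^ n := pow_succ' r n
  have hB : growthBound r n =
      growthBound r (n + 1) * Real.exp (5 / (1 - r) ^ 2 * r ^ n) := by
    rw [growthBound, growthBound, ← Real.exp_add, hx]
    congr 1
    field_simp
    ring
  have hE := Real.add_one_le_exp (5 / (1 - r) ^ 2 * r ^ n)
  rw [hB, mul_assoc, hx]
  refine mul_le_mul_of_nonneg_left ?_ (Real.exp_pos _).le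
  generalize r ^ n = y at *
  have hA : (1 - r) ^ 2 ≤ (1 - r * y) * (1 - r * y * y) := by
    rw [sq]
    have : r * y ≤ r := by nlinarith
    have : r * y * y ≤ r := by nlinarith [mul_nonneg h0 hy0]
    exact mul_le_mul (by linarith) (by linarith) hd.le (by linarith)
  have hA' : 1 - 2 * y ≤ (1 - r * y) * (1 - r * y * y) := by
    have : r * y ≤ y := by nlinarith
    have : r * y * y ≤ y := by nlinarith [mul_nonneg h0 hy0]
    have : 0 ≤ (r * y) * (r * y * y) := by positivity
    nlinarith
  have hk : 5 * y ≤ 5 / (1 - r) ^ 2 * y * ((1 - r * y) * (1 - r * y * y)) := by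
    calc 5 * y = 5 / (1 - r) ^ 2 * y * (1 - r) ^ 2 := by field_simp
      _ ≤ _ := by gcongr
  calc (1 + r * y) * (1 + r * y) ≤ 1 + 3 * y := by
        have : r * y ≤ y := by nlinarith
        have : 0 ≤ r * y := by positivity
        nlinarith
    _ ≤ (5 / (1 - r) ^ 2 * y + 1) * ((1 - r * y) * (1 - r * y * y)) := by linarith
    _ ≤ _ := by
        refine mul_le_mul_of_nonneg_right hE (le_trans (by positivity) hA)

/-- A bound for the sum of `r ^ |R|` over the sequences `R` stacked on `n` coloured `c_1`. -/
noncomputable def growthBoundOne (r : ℝ) (n : ℕ) : ℝ :=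
  (1 + r ^ n) * growthBound r n / (1 - r ^ n)

/-- A bound for the sum of `r ^ |R|` over the sequences `R` stacked on `n + 1` coloured `c_0`. -/
noncomputable def growthBoundZero (r : ℝ) (n : ℕ) : ℝ :=
  growthBoundOne r (n + 1) + r ^ n * growthBound r n

theorem growthBoundOne_eq (h0 : 0 ≤ r) (h1 : r < 1) (n : ℕ) :
    growthBound r (n + 1) + (r ^ (n + 1) * growthBoundOne r (n + 1) +
      r ^ (n + 1) * growthBound r (n + 1)) = growthBoundOne r (n + 1) := by
  have : 1 - r ^ (n + 1) ≠ 0 := by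
    have := pow_lt_one₀ h0 h1 (Nat.add_one_ne_zero n)
    linarith
  unfold growthBoundOne
  field_simp
  ring

theorem growthBound_le (h0 : 0 ≤ r) (h1 : r < 1) (n : ℕ) :
    growthBound r (n + 1) + (r ^ (n + 1) * growthBound r (n + 1) +
      (r ^ (n + 1) * growthBoundOne r (n + 1) + r ^ (n + 1) * growthBoundZero r n)) ≤
      growthBound r n := by
  have hx : 0 < 1 - r ^ (n + 1) := by
    have := pow_lt_one₀ h0 h1 (Nat.add_one_ne_zero n)
    linarith
  have h := growthBound_step h0 h1 n
  rw [← sub_nonneg]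
  have key : growthBound r n - (growthBound r (n + 1) + (r ^ (n + 1) * growthBound r (n + 1) +
      (r ^ (n + 1) * growthBoundOne r (n + 1) + r ^ (n + 1) * growthBoundZero r n))) =
      (growthBound r n * ((1 - r ^ (n + 1)) * (1 - r ^ (n + 1) * r ^ n)) -
      growthBound r (n + 1) * ((1 + r ^ (n + 1)) * (1 + r ^ (n + 1)))) / (1 - r ^ (n + 1)) := by
    unfold growthBoundZero growthBoundOne
    field_simp
    ring
  rw [key]
  exact div_nonneg (sub_nonneg.2 h) hx.le

theorem growthBoundOne_nonneg (h0 : 0 ≤ r) (h1 : r < 1) (n : ℕ) : 0 ≤ growthBoundOne r n := by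
  have hx : 0 ≤ 1 - r ^ n := sub_nonneg.2 (pow_le_one₀ h0 h1.le)
  have := one_le_growthBound h0 h1 n
  unfold growthBoundOne
  positivity

theorem growthBoundZero_nonneg (h0 : 0 ≤ r) (h1 : r < 1) (n : ℕ) :
    0 ≤ growthBoundZero r n := by
  have := one_le_growthBound h0 h1 n
  have := growthBoundOne_nonneg h0 h1 (n + 1)
  unfold growthBoundZero
  positivity

theorem exists_hasSum_truncWeight (h0 : 0 ≤ r) (h1 : r < 1) (M N n : ℕ) :
    (∃ a ≤ growthBound r n, HasSum ((StackedOn (n, 2)).indicator (truncWeight r M N)) a) ∧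
    (∃ a ≤ growthBoundOne r (n + 1),
      HasSum ((StackedOn (n + 1, 1)).indicator (truncWeight r M N)) a) ∧
    ∃ a ≤ growthBoundZero r n,
      HasSum ((StackedOn (n + 1, 0)).indicator (truncWeight r M N)) a := by
  have hx {j : ℕ} (k : ℕ) {a b : ℝ} (hab : a ≤ b) (hb : 0 ≤ b) :
      (if ((k : ℤ), j).1 ≤ M then r ^ ((k : ℤ), j).1.toNat else 0) * a ≤ r ^ k * b := by
    have : 0 ≤ r ^ k := by positivity
    dsimp only
    rw [Int.toNat_natCast]
    split_ifs
    · gcongr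
    · rw [zero_mul]; positivity
  have hB0 (k : ℕ) : 0 ≤ growthBound r k := zero_le_one.trans (one_le_growthBound h0 h1 k)
  have hC0 := growthBoundOne_nonneg h0 h1
  have hD0 := growthBoundZero_nonneg h0 h1
  induction N generalizing n with
  | zero =>
    have key (s : ℤ × ℕ) : HasSum ((StackedOn s).indicator (truncWeight r M 0)) 1 :=
      hasSum_indicator_of_eq_zero (truncWeight_nil M 0) fun t R _ => by simp [truncWeight]
    have hC : 1 ≤ growthBoundOne r (n + 1) := by
      rw [← growthBoundOne_eq h0 h1 n]
      have := one_le_growthBound h0 h1 (n + 1)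
      have := hC0 (n + 1)
      have := hB0 (n + 1)
      have : 0 ≤ r ^ (n + 1) * growthBoundOne r (n + 1) +
        r ^ (n + 1) * growthBound r (n + 1) := by positivity
      linarith
    refine ⟨⟨1, one_le_growthBound h0 h1 n, key _⟩, ⟨1, hC, key _⟩, ⟨1, ?_, key _⟩⟩
    have := hB0 n
    have : 0 ≤ r ^ n * growthBound r n := by positivity
    unfold growthBoundZero
    linarith
  | succ N ih =>
    have hw := truncWeight_cons (r := r) M N
    have two (n : ℕ) : ∃ a ≤ growthBound r n,
        HasSum ((StackedOn (n, 2)).indicator (truncWeight r M (N + 1))) a := by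
      rcases le_total M n with h | h
      · refine ⟨1, one_le_growthBound h0 h1 n,
          hasSum_indicator_of_eq_zero (truncWeight_nil M _) fun t R hR => ?_⟩
        have hst := (cons_mem_stackedOn.1 hR).2.1
        simp only [StepGG, H2] at hst
        rw [hw, if_neg (by grind), zero_mul]
      · induction h using Nat.decreasingInduction with
        | self =>
          refine ⟨1, one_le_growthBound h0 h1 M,
            hasSum_indicator_of_eq_zero (truncWeight_nil M _) fun t R hR => ?_⟩
          have hst := (cons_mem_stackedOn.1 hR).2.1
          simp only [StepGG, H2] at hst
          rw [hw, if_neg (by grind), zero_mul]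
        | of_succ n hn ih' =>
          obtain ⟨a, ha, hsa⟩ := ih'
          obtain ⟨b, hb, hsb⟩ := (ih (n + 1)).1
          obtain ⟨-, ⟨c, hc, hsc⟩, ⟨d, hd, hsd⟩⟩ := ih n
          push_cast at hsa hsb
          refine ⟨_, ?_, hasSum_stackedOn_two hw n hsa hsb hsc hsd⟩
          refine le_trans ?_ (growthBound_le h0 h1 n)
          have e1 := hx (j := 2) (n + 1) hb (hB0 _)
          have e2 := hx (j := 1) (n + 1) hc (hC0 _)
          have e3 := hx (j := 0) (n + 1) hd (hD0 _)
          push_cast at e1 e2 e3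
          linarith
    have one : ∃ a ≤ growthBoundOne r (n + 1),
        HasSum ((StackedOn (n + 1, 1)).indicator (truncWeight r M (N + 1))) a := by
      obtain ⟨a, ha, hsa⟩ := two (n + 1)
      obtain ⟨b, hb, hsb⟩ := (ih (n + 1)).1
      obtain ⟨c, hc, hsc⟩ := (ih n).2.1
      push_cast at hsa hsb
      refine ⟨_, ?_, hasSum_stackedOn_one hw (n + 1) hsa hsc hsb⟩
      rw [← growthBoundOne_eq h0 h1 n]
      have e1 := hx (j := 2) (n + 1) hb (hB0 _)
      have e2 := hx (j := 1) (n + 1) hc (hC0 _)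
      push_cast at e1 e2
      linarith
    refine ⟨two n, one, ?_⟩
    obtain ⟨a, ha, hsa⟩ := one
    obtain ⟨b, hb, hsb⟩ := (ih n).1
    refine ⟨_, ?_, hasSum_stackedOn_zero hw n hsa hsb⟩
    exact add_le_add ha (hx n hb (hB0 _))

theorem summable_sizeWeight (h0 : 0 ≤ r) {S : Set (List (ℤ × ℕ))} {C : ℝ}
    (hS : ∀ M N, ∃ a ≤ C, HasSum (S.indicator (truncWeight r M N)) a) :
    Summable (S.indicator (sizeWeight r)) := by
  refine summable_of_sum_le (c := C) ?_ fun u => ?_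
  · exact Set.indicator_nonneg fun R _ => sizeWeight_nonneg h0 R
  · let N := u.sup List.length
    let M := u.sup fun R => (R.map fun p => p.1.toNat).sum
    obtain ⟨a, ha, hsa⟩ := hS M N
    refine le_trans (le_of_eq (Finset.sum_congr rfl fun R hR => ?_)) ((sum_le_hasSum u
      (fun R _ => Set.indicator_nonneg (fun R _ => truncWeight_nonneg h0 M N R) R) hsa).trans ha)
    by_cases hRS : R ∈ S
    · rw [Set.indicator_of_mem hRS, Set.indicator_of_mem hRS, truncWeight, if_pos]
      refine ⟨Finset.le_sup (f := List.length) hR, fun p hp => ?_⟩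
      have h1 := Finset.le_sup (f := fun R => (R.map fun p => p.1.toNat).sum) hR
      have h2 := List.single_le_sum (l := R.map fun p => p.1.toNat) (by simp) _
        (List.mem_map_of_mem (f := fun p => p.1.toNat) hp)
      have h3 : (p.1.toNat : ℤ) ≤ M := by exact_mod_cast h2.trans h1
      exact (Int.self_le_toNat _).trans h3
    · rw [Set.indicator_of_notMem hRS, Set.indicator_of_notMem hRS]

end Bound

/-- The contribution `c_j q ^ p` of a part `p` coloured `c_j`, negative parts counting as `0`. -/
noncomputable def partWeight (q c0 c1 c2 : ℂ) (p : ℤ × ℕ) : ℂ :=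
  (if p.2 = 0 then c0 else if p.2 = 1 then c1 else c2) * q ^ p.1.toNat

/-- The contribution `C(R) q ^ |R|` of a coloured sequence. -/
noncomputable def seqWeight (q c0 c1 c2 : ℂ) (R : List (ℤ × ℕ)) : ℂ :=
  (R.map (partWeight q c0 c1 c2)).prod

section Series

variable {q c0 c1 c2 : ℂ}

theorem seqWeight_cons (t : ℤ × ℕ) (R : List (ℤ × ℕ)) :
    seqWeight q c0 c1 c2 (t :: R) = partWeight q c0 c1 c2 t * seqWeight q c0 c1 c2 R := by
  simp [seqWeight]

theorem norm_seqWeight_le (h0 : ‖c0‖ ≤ 1) (h1 : ‖c1‖ ≤ 1) (h2 : ‖c2‖ ≤ 1)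
    (R : List (ℤ × ℕ)) : ‖seqWeight q c0 c1 c2 R‖ ≤ sizeWeight ‖q‖ R := by
  induction R with
  | nil => simp [seqWeight, sizeWeight]
  | cons t R ih =>
    have ht : ‖partWeight q c0 c1 c2 t‖ ≤ ‖q‖ ^ t.1.toNat := by
      rw [partWeight, norm_mul, norm_pow]
      refine mul_le_of_le_one_left (by positivity) ?_
      split_ifs <;> assumption
    have hs : sizeWeight ‖q‖ (t :: R) = ‖q‖ ^ t.1.toNat * sizeWeight ‖q‖ R := by
      simp [sizeWeight]
    rw [seqWeight_cons, norm_mul, hs]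
    gcongr

theorem summable_seqWeight (h0 : ‖c0‖ ≤ 1) (h1 : ‖c1‖ ≤ 1) (h2 : ‖c2‖ ≤ 1)
    {S : Set (List (ℤ × ℕ))} (hS : Summable (S.indicator (sizeWeight ‖q‖))) :
    Summable (S.indicator (seqWeight q c0 c1 c2)) := by
  refine hS.of_norm_bounded fun R => ?_
  rw [norm_indicator_eq_indicator_norm]
  exact Set.indicator_le_indicator (norm_seqWeight_le h0 h1 h2 R)

/-- The generating function of the sequences stacked on `n` coloured `c_2`. -/
noncomputable def stackSum (q c0 c1 c2 : ℂ) (n : ℕ) : ℂ :=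
  ∑' R, (StackedOn (n, 2)).indicator (seqWeight q c0 c1 c2) R

theorem summable_stackedOn_two (hq : ‖q‖ < 1) (n : ℕ) :
    Summable ((StackedOn (n, 2)).indicator (sizeWeight ‖q‖)) :=
  summable_sizeWeight (norm_nonneg q)
    fun M N => (exists_hasSum_truncWeight (norm_nonneg q) hq M N n).1

theorem hasSum_stackSum (hq : ‖q‖ < 1) (h0 : ‖c0‖ ≤ 1) (h1 : ‖c1‖ ≤ 1) (h2 : ‖c2‖ ≤ 1)
    (n : ℕ) :
    HasSum ((StackedOn (n, 2)).indicator (seqWeight q c0 c1 c2)) (stackSum q c0 c1 c2 n) :=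
  (summable_seqWeight h0 h1 h2 (summable_stackedOn_two hq n)).hasSum

theorem stackSum_recurrence (hq : ‖q‖ < 1) (h0 : ‖c0‖ ≤ 1) (h1 : ‖c1‖ ≤ 1) (h2 : ‖c2‖ ≤ 1)
    (n : ℕ) :
    stackSum q c0 c1 c2 n *
        ((1 - c1 * q * q ^ n) * (1 - c0 * c2 * q * (q ^ 2) ^ n)) =
      stackSum q c0 c1 c2 (n + 1) * ((1 - -c0 * q * q ^ n) * (1 - -c2 * q ^ (n + 1))) := by
  have hr := norm_nonneg q
  have hb := fun M N => exists_hasSum_truncWeight hr hq M N n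
  obtain ⟨c, hc⟩ := summable_seqWeight h0 h1 h2
    (summable_sizeWeight hr fun M N => (hb M N).2.1)
  obtain ⟨d, hd⟩ := summable_seqWeight h0 h1 h2
    (summable_sizeWeight hr fun M N => (hb M N).2.2)
  have ha := hasSum_stackSum hq h0 h1 h2 n
  have ha' := hasSum_stackSum hq h0 h1 h2 (n + 1)
  push_cast at ha'
  have hw := seqWeight_cons (q := q) (c0 := c0) (c1 := c1) (c2 := c2)
  have e2 := ha.unique (hasSum_stackedOn_two hw n ha' ha' hc hd)
  have e1 := hc.unique (hasSum_stackedOn_one hw (n + 1) ha' hc ha')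
  have e0 := hd.unique (hasSum_stackedOn_zero hw n hc ha)
  have hn : ((n : ℤ) + 1).toNat = n + 1 := by omega
  simp only [partWeight, hn, Int.toNat_natCast, if_true, if_false, OfNat.ofNat_ne_zero,
    OfNat.ofNat_ne_one, one_ne_zero] at e2 e1 e0
  generalize stackSum q c0 c1 c2 n = A at *
  generalize stackSum q c0 c1 c2 (n + 1) = A' at *
  rw [← pow_mul, mul_comm 2 n, pow_mul]
  simp only [pow_succ] at e2 e1 e0 ⊢
  generalize q ^ n = y at *
  linear_combination (1 - c1 * q * y) * e2 + (c1 * q * y + c0 * q * y) * e1 +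
    (1 - c1 * q * y) * (c0 * q * y) * e0

theorem tendsto_stackSum (hq : ‖q‖ < 1) (h0 : ‖c0‖ ≤ 1) (h1 : ‖c1‖ ≤ 1) (h2 : ‖c2‖ ≤ 1) :
    Filter.Tendsto (stackSum q c0 c1 c2) Filter.atTop (nhds 1) := by
  have hs : HasSum (({[]} : Set (List (ℤ × ℕ))).indicator (seqWeight q c0 c1 c2)) 1 := by
    convert hasSum_single (f := ({[]} : Set (List (ℤ × ℕ))).indicator (seqWeight q c0 c1 c2))
      [] ?_ using 1
    · simp [seqWeight]
    · intro R hR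
      exact Set.indicator_of_notMem (by simpa using hR) _
  rw [← hs.tsum_eq]
  refine tendsto_tsum_of_dominated_convergence (summable_stackedOn_two hq 0) (fun R => ?_)
    (Filter.Eventually.of_forall fun n R => ?_)
  · refine tendsto_const_nhds.congr' ?_
    rcases R with _ | ⟨t, R⟩
    · filter_upwards with n
      rw [Set.indicator_of_mem (nil_mem_stackedOn _), Set.indicator_of_mem (Set.mem_singleton _)]
    · filter_upwards [Filter.eventually_ge_atTop t.1.toNat] with n hn
      rw [Set.indicator_of_notMem (by simp), Set.indicator_of_notMem]
      intro hR
      have hst := (cons_mem_stackedOn.1 hR).2.1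
      simp only [StepGG, H2] at hst
      grind
  · rw [norm_indicator_eq_indicator_norm]
    refine (Set.indicator_le_indicator (norm_seqWeight_le h0 h1 h2 R)).trans ?_
    exact Set.indicator_le_indicator_of_subset (stackedOn_two_anti (by positivity))
      (fun R => sizeWeight_nonneg (norm_nonneg q) R) R

end Series

theorem summable_norm_mul_pow {a q : ℂ} (hq : ‖q‖ < 1) :
    Summable fun k : ℕ => ‖-(a * q ^ k)‖ := by
  simp only [norm_neg, norm_mul, norm_pow]
  exact (summable_geometric_of_lt_one (norm_nonneg q) hq).mul_left _

theorem tendsto_qPoch {q : ℂ} (a : ℂ) (hq : ‖q‖ < 1) :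
    Filter.Tendsto (fun n => ∏ k ∈ Finset.range n, (1 - a * q ^ k)) Filter.atTop
      (nhds (qPoch a q)) := by
  have h := multipliable_one_add_of_summable (summable_norm_mul_pow (a := a) hq)
  simp only [← sub_eq_add_neg] at h
  exact h.hasProd.tendsto_prod_nat

theorem qPoch_ne_zero {a q : ℂ} (hq : ‖q‖ < 1) (ha : ‖a‖ < 1) : qPoch a q ≠ 0 := by
  have h := tprod_one_add_ne_zero_of_summable (f := fun k : ℕ => -(a * q ^ k)) (fun k h => ?_)
    (summable_norm_mul_pow hq)
  · simpa only [qPoch, ← sub_eq_add_neg] using h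
  · have h' : a * q ^ k = 1 := by linear_combination -h
    have hlt : ‖a * q ^ k‖ < 1 := by
      rw [norm_mul, norm_pow]
      exact mul_lt_one_of_nonneg_of_lt_one_left (norm_nonneg a) ha
        (pow_le_one₀ (norm_nonneg q) hq.le)
    rw [h', norm_one] at hlt
    exact lt_irrefl _ hlt

theorem stackSum_zero_mul {q c0 c1 c2 : ℂ} (hq : ‖q‖ < 1) (h0 : ‖c0‖ ≤ 1) (h1 : ‖c1‖ ≤ 1)
    (h2 : ‖c2‖ ≤ 1) :
    (1 + c2) * stackSum q c0 c1 c2 0 * (qPoch (c1 * q) q * qPoch (c0 * c2 * q) (q ^ 2)) =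
      qPoch (-c0 * q) q * qPoch (-c2) q := by
  have hq2 : ‖q ^ 2‖ < 1 := by
    rw [norm_pow]
    exact pow_lt_one₀ (norm_nonneg q) hq two_ne_zero
  have key (n : ℕ) : (1 + c2) * stackSum q c0 c1 c2 0 *
      ((∏ k ∈ Finset.range n, (1 - c1 * q * q ^ k)) *
        ∏ k ∈ Finset.range n, (1 - c0 * c2 * q * (q ^ 2) ^ k)) =
      stackSum q c0 c1 c2 n * ((∏ k ∈ Finset.range n, (1 - -c0 * q * q ^ k)) *
        ∏ k ∈ Finset.range (n + 1), (1 - -c2 * q ^ k)) := by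
    induction n with
    | zero => simp; ring
    | succ n ih =>
      have h := stackSum_recurrence hq h0 h1 h2 n
      rw [Finset.prod_range_succ, Finset.prod_range_succ _ n, Finset.prod_range_succ _ n,
        Finset.prod_range_succ _ (n + 1)]
      linear_combination (1 - c1 * q * q ^ n) * (1 - c0 * c2 * q * (q ^ 2) ^ n) * ih +
        (∏ k ∈ Finset.range n, (1 - -c0 * q * q ^ k)) *
          (∏ k ∈ Finset.range (n + 1), (1 - -c2 * q ^ k)) * h
  have hL := ((tendsto_qPoch (c1 * q) hq).mul (tendsto_qPoch (c0 * c2 * q) hq2)).const_mul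
    ((1 + c2) * stackSum q c0 c1 c2 0)
  have hR := (tendsto_stackSum hq h0 h1 h2).mul ((tendsto_qPoch (-c0 * q) hq).mul
    ((tendsto_qPoch (-c2) hq).comp (Filter.tendsto_add_atTop_nat 1)))
  rw [one_mul] at hR
  exact tendsto_nhds_unique (hL.congr key) hR

/-- The sequences of non-ground parts of grounded partitions, listed from the smallest part
upwards. -/
def GroundedTail : Set (List (ℤ × ℕ)) :=
  StackedOn (0, 2) ∪ List.cons (0, 2) '' StackedOn (0, 2)

theorem mem_groundedTail {R : List (ℤ × ℕ)} :
    R ∈ GroundedTail ↔ R ∈ StackedOn (0, 1) ∧ ∀ p ∈ R[0]?, p ≠ (0, 1) := by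
  rw [GroundedTail, stackedOn_one]
  rcases R with _ | ⟨t, R⟩
  · simp [nil_mem_stackedOn]
  · have h : t :: R ∈ StackedOn (0, 2) → t ≠ (0, 1) := by
      rintro h rfl
      simpa [StepGG, H2] using (cons_mem_stackedOn.1 h).2.1
    simp only [Set.mem_union, Set.mem_image, List.cons.injEq, List.getElem?_cons_zero,
      Option.mem_def, Option.some.injEq, forall_eq']
    constructor
    · rintro (hR | ⟨R', hR, rfl, rfl⟩)
      · exact ⟨Or.inl hR, h hR⟩
      · exact ⟨Or.inr (Or.inr ⟨R', hR, rfl, rfl⟩), by simp⟩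
    · rintro ⟨hR | ⟨R', hR, rfl, rfl⟩ | ⟨R', hR, rfl, rfl⟩, ht⟩
      · exact Or.inl hR
      · exact absurd rfl ht
      · exact Or.inr ⟨R', hR, rfl, rfl⟩

theorem grounded1_reverse_cons {R : List (ℤ × ℕ)} :
    Grounded1 (((0, 1) :: R).reverse) ↔ R ∈ GroundedTail := by
  rw [mem_groundedTail, Grounded1, StackedOn]
  simp only [List.mem_reverse, List.forall_mem_cons, List.getLast?_reverse, List.head?_cons,
    List.reverse_reverse, List.getElem?_cons_succ, Set.mem_ofPred_eq, true_and]
  have h : List.Chain' StepGG ((0, 1) :: R).reverse ↔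
      ((0, 1) :: R).IsChain fun y x => StepGG x y := List.isChain_reverse
  rw [h]
  norm_num
  tauto

theorem Grounded1.exists_eq {L : List (ℤ × ℕ)} (h : Grounded1 L) :
    ∃ R, ((0, 1) :: R).reverse = L := by
  obtain ⟨ys, rfl⟩ := List.getLast?_eq_some_iff.1 h.2.2.1
  exact ⟨ys.reverse, by simp⟩

theorem weight_eq_seqWeight (q c0 c1 c2 : ℂ) {R : List (ℤ × ℕ)} (hc : ∀ p ∈ R, p.2 ≤ 2)
    (hp : ∀ p ∈ R, 0 ≤ p.1) :
    c0 ^ (R.countP fun p => p.2 == 0) * c1 ^ (R.countP fun p => p.2 == 1) *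
      c2 ^ (R.countP fun p => p.2 == 2) * q ^ ((R.map Prod.fst).sum) =
      seqWeight q c0 c1 c2 R := by
  induction R with
  | nil => simp [seqWeight]
  | cons t R ih =>
    obtain ⟨m, j⟩ := t
    simp only [List.forall_mem_cons] at hc hp
    obtain ⟨m, rfl⟩ := Int.eq_ofNat_of_zero_le hp.1
    have hs : 0 ≤ (R.map Prod.fst).sum := by
      refine List.sum_nonneg fun x hx => ?_
      obtain ⟨p, hpR, rfl⟩ := List.mem_map.1 hx
      exact hp.2 p hpR
    rw [seqWeight_cons, ← ih hc.2 hp.2, List.map_cons, List.sum_cons]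
    obtain ⟨s, hs⟩ := Int.eq_ofNat_of_zero_le hs
    rw [hs, ← Nat.cast_add, zpow_natCast, zpow_natCast]
    have hj := hc.1
    interval_cases j <;> simp [partWeight] <;> ring

/-- The generating function of grounded partitions with ground `c_1` and relation `≫`:
`∑_{π ∈ 𝒫^≫_{c_1}} C(π) q^{|π|}
  = c_1 (−c_0 q; q)_∞ (−c_2; q)_∞ / ((c_1 q; q)_∞ (c_0 c_2 q; q²)_∞)`. -/
theorem groundedC1GenFun (q c0 c1 c2 : ℂ) (hq : ‖q‖ < 1)
    (h0 : ‖c0‖ ≤ 1) (h1 : ‖c1‖ ≤ 1) (h2 : ‖c2‖ ≤ 1) :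
    genFun Grounded1 q c0 c1 c2 =
      c1 * qPoch (-c0 * q) q * qPoch (-c2) q /
        (qPoch (c1 * q) q * qPoch (c0 * c2 * q) (q ^ 2)) := by
  have ha := hasSum_stackSum hq h0 h1 h2 0
  rw [Nat.cast_zero] at ha
  have hG : HasSum (GroundedTail.indicator (seqWeight q c0 c1 c2))
      (stackSum q c0 c1 c2 0 + partWeight q c0 c1 c2 (0, 2) * stackSum q c0 c1 c2 0) :=
    ha.indicator_union (ha.indicator_image_cons (seqWeight_cons _))
      (disjoint_stackedOn_image_cons (by simp [StepGG, H2]) _)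
  have hsum : genFun Grounded1 q c0 c1 c2 = c1 * ((1 + c2) * stackSum q c0 c1 c2 0) := by
    refine HasSum.tsum_eq ?_
    refine (hasSum_subtype_iff_indicator (s := {L | Grounded1 L}) (f := fun L : List (ℤ × ℕ) =>
      c0 ^ (L.countP fun p => p.2 == 0) * c1 ^ (L.countP fun p => p.2 == 1) *
        c2 ^ (L.countP fun p => p.2 == 2) * q ^ ((L.map Prod.fst).sum))).2 ?_
    have hinj : Function.Injective fun R : List (ℤ × ℕ) => ((0, 1) :: R).reverse :=
      List.reverse_injective.comp List.cons_injective
    have hv : c1 * ((1 + c2) * stackSum q c0 c1 c2 0) =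
        c1 * (stackSum q c0 c1 c2 0 + partWeight q c0 c1 c2 (0, 2) * stackSum q c0 c1 c2 0) := by
      have hw : partWeight q c0 c1 c2 (0, 2) = c2 := by simp [partWeight]
      rw [hw]
      ring
    rw [hv, ← hinj.hasSum_iff]
    · refine (hG.mul_left c1).congr_fun fun R => ?_
      by_cases hR : R ∈ GroundedTail
      · have hR' := (mem_groundedTail.1 hR).1
        have hp := nonneg_of_mem_stackedOn (le_refl 0) (by simp) hR'
        rw [Function.comp_apply, Set.indicator_of_mem hR,
          Set.indicator_of_mem (show _ ∈ {L | Grounded1 L} from grounded1_reverse_cons.2 hR),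
          ← weight_eq_seqWeight q c0 c1 c2 hR'.1 hp]
        simp only [List.countP_reverse, List.map_reverse, List.sum_reverse, List.countP_cons,
          List.map_cons, List.sum_cons]
        simp
        ring
      · rw [Function.comp_apply, Set.indicator_of_notMem hR, mul_zero,
          Set.indicator_of_notMem]
        exact fun h => hR (grounded1_reverse_cons.1 h)
    · intro L hL
      exact Set.indicator_of_notMem
        (fun h : L ∈ {L | Grounded1 L} => hL (Grounded1.exists_eq h)) _
  have hq2 : ‖q ^ 2‖ < 1 := by
    rw [norm_pow]
    exact pow_lt_one₀ (norm_nonneg q) hq two_ne_zero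
  have hc1 : ‖c1 * q‖ < 1 := by
    rw [norm_mul]
    exact mul_lt_one_of_nonneg_of_lt_one_right h1 (norm_nonneg q) hq
  have hc02 : ‖c0 * c2 * q‖ < 1 := by
    rw [norm_mul, norm_mul]
    exact mul_lt_one_of_nonneg_of_lt_one_right (mul_le_one₀ h0 (norm_nonneg _) h2)
      (norm_nonneg q) hq
  rw [hsum, eq_div_iff (mul_ne_zero (qPoch_ne_zero hq hc1) (qPoch_ne_zero hq2 hc02)), mul_assoc,
    stackSum_zero_mul hq h0 h1 h2, mul_assoc]
end
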